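/- arXiv:math/0207076 — 3 statements merged into one kernel-verified Lean document; each statement's English description precedes it below -/
import Mathlib

section
/- Let P be any one-parameter deformation of a FISI polynomial f₀ of degree d ≥ 2. Then there exists ε > 0 such that Y has no singular point with |s| < ε if and only if Σ₀ ∩ {φ_d = 0} = ∅ (i.e. there is no [x] ∈ ℙ^{n−1} with ∂P_d/∂x_i(x,0) = 0 for all i, P_{d−1}(x,0) = 0 and ∂P_d/∂s(x,0) = 0). In this case, after possibly shrinking ε, the set of critical points of the projection σ : Y → ℂ lying in {|s| < ε} — namely the points of Y at which all partial derivatives of the defining equation P̃(x,x₀,s) − t x₀^d with respect to the homogeneous coordinates (x, x₀) and to t vanish — is exactly Σ₀ × {0} × ℂ; in particular Σ_s = ∅ for 0 < |s| < ε. -/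
open MvPolynomial Filter CategoryTheory Limits Topology

noncomputable section

abbrev XS (n : ℕ) := Fin n ⊕ Unit
abbrev HV (n : ℕ) := Fin n ⊕ Unit
abbrev TV (n : ℕ) := Fin n ⊕ Fin 3

/-- ℙ^{n-1}, the hyperplane at infinity of ℙⁿ. -/
abbrev PrjInf (n : ℕ) := Projectivization ℂ (Fin n → ℂ)
/-- ℙⁿ. -/
abbrev Prj (n : ℕ) := Projectivization ℂ (HV n → ℂ)

/-- weights for the degree in the `x`-variables only: `s` has weight `0`. -/
def wtx (n : ℕ) : XS n → ℕ := Sum.elim (fun _ => 1) (fun _ => 0)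

/-- `P_q`, the degree-`q` homogeneous part of `P` in the variables `x`. -/
def xpart {n : ℕ} (P : MvPolynomial (XS n) ℂ) (q : ℕ) : MvPolynomial (XS n) ℂ :=
  weightedHomogeneousComponent (wtx n) q P

/-- the evaluation point `(x, s)`. -/
def evA {n : ℕ} (x : Fin n → ℂ) (s : ℂ) : XS n → ℂ := Sum.elim x (fun _ => s)

/-- `deg_x P(·,s) = d` at the parameter value `s`. -/
def DegXAt {n : ℕ} (d : ℕ) (P : MvPolynomial (XS n) ℂ) (s : ℂ) : Prop :=
  (∀ q, d < q → ∀ x : Fin n → ℂ, eval (evA x s) (xpart P q) = 0) ∧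
  (∃ x : Fin n → ℂ, eval (evA x s) (xpart P d) ≠ 0)

/-- the substitution embedding the variables `(x,s)` into the variables `(x,x₀,s,t)`. -/
def embT {n : ℕ} : XS n → MvPolynomial (TV n) ℂ :=
  Sum.elim (fun i => X (Sum.inl i)) (fun _ => X (Sum.inr 1))

/-- The defining polynomial `F = P̃(x,x₀,s) - t·x₀^d` of the total space
`Y ⊂ ℙⁿ × ℂ_s × ℂ_t`, where `P̃ = Σ_{q ≤ d} x₀^{d-q} P_q(x,s)` is the homogenization
of `P` in `x` by the variable `x₀`. -/
def FY {n : ℕ} (d : ℕ) (P : MvPolynomial (XS n) ℂ) : MvPolynomial (TV n) ℂ :=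
  (∑ q ∈ Finset.range (d+1), (X (Sum.inr 0))^(d-q) * aeval embT (xpart P q))
    - X (Sum.inr 2) * (X (Sum.inr 0))^d

/-- the evaluation point `((x,x₀), s, t)` of the variables of `FY`. -/
def evT {n : ℕ} (u : HV n → ℂ) (s t : ℂ) : TV n → ℂ :=
  Sum.elim (fun i => u (Sum.inl i)) ![u (Sum.inr ()), s, t]

/-- `([u], s, t) ∈ Y`. -/
def OnY {n : ℕ} (d : ℕ) (P : MvPolynomial (XS n) ℂ) (u : HV n → ℂ) (s t : ℂ) : Prop :=
  eval (evT u s t) (FY d P) = 0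

/-- all partial derivatives of the defining equation of `Y` — with respect to the
homogeneous coordinates `(x, x₀)` and the affine coordinates `s, t` — vanish at
`([u], s, t)`; together with `OnY` this says `([u],s,t)` is a singular point of `Y`. -/
def AllDerivsVanish {n : ℕ} (d : ℕ) (P : MvPolynomial (XS n) ℂ) (u : HV n → ℂ)
    (s t : ℂ) : Prop :=
  ∀ v : TV n, eval (evT u s t) (pderiv v (FY d P)) = 0

/-- the partial derivatives with respect to the homogeneous coordinates `(x, x₀)`
vanish at `([u], s, t)`; together with `OnY` this says `[u]` is a singular point of the
projective fiber `Y_{s,t}`. -/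
def FiberDerivsVanish {n : ℕ} (d : ℕ) (P : MvPolynomial (XS n) ℂ) (u : HV n → ℂ)
    (s t : ℂ) : Prop :=
  (∀ i : Fin n, eval (evT u s t) (pderiv (Sum.inl i) (FY d P)) = 0) ∧
    eval (evT u s t) (pderiv (Sum.inr 0) (FY d P)) = 0

/-- the partial derivatives with respect to `(x, x₀)` and `t` (but not `s`) vanish;
together with `OnY` this identifies the singular points of `Y_{s,ℂ}`, resp. the critical
points of the projection `σ : Y → ℂ_s`. -/
def SliceDerivsVanish {n : ℕ} (d : ℕ) (P : MvPolynomial (XS n) ℂ) (u : HV n → ℂ)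
    (s t : ℂ) : Prop :=
  FiberDerivsVanish d P u s t ∧ eval (evT u s t) (pderiv (Sum.inr 2) (FY d P)) = 0

/-- `[x] ∈ W_s`: all `∂P_d/∂x_i` vanish at `(x,s)`. -/
def WCond {n : ℕ} (d : ℕ) (P : MvPolynomial (XS n) ℂ) (x : Fin n → ℂ) (s : ℂ) : Prop :=
  ∀ i : Fin n, eval (evA x s) (pderiv (Sum.inl i) (xpart P d)) = 0

/-- `[x] ∈ Σ_s`: moreover `P_{d-1}(x,s) = 0`. -/
def SCond {n : ℕ} (d : ℕ) (P : MvPolynomial (XS n) ℂ) (x : Fin n → ℂ) (s : ℂ) : Prop :=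
  WCond d P x s ∧ eval (evA x s) (xpart P (d-1)) = 0

/-- `φ_d(x) = ∂P_d/∂s (x, 0) = 0`. -/
def PhiCond {n : ℕ} (d : ℕ) (P : MvPolynomial (XS n) ℂ) (x : Fin n → ℂ) : Prop :=
  eval (evA x 0) (pderiv (Sum.inr ()) (xpart P d)) = 0

/-- `W_s ⊂ ℙ^{n-1}` as a set of projective points. -/
def Wset {n : ℕ} (d : ℕ) (P : MvPolynomial (XS n) ℂ) (s : ℂ) : Set (PrjInf n) :=
  {p | WCond d P p.rep s}

/-- `Σ_s ⊂ ℙ^{n-1}` as a set of projective points. -/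
def Sigset {n : ℕ} (d : ℕ) (P : MvPolynomial (XS n) ℂ) (s : ℂ) : Set (PrjInf n) :=
  {p | SCond d P p.rep s}

/-- `f_s = P(·,s)` as a polynomial in `x`. -/
def fS {n : ℕ} (P : MvPolynomial (XS n) ℂ) (s : ℂ) : MvPolynomial (Fin n) ℂ :=
  aeval (Sum.elim X (fun _ => C s)) P

/-- `x` is an affine critical point of `f_s`, i.e. `∂P/∂x_i(x,s) = 0` for all `i`. -/
def CritPt {n : ℕ} (P : MvPolynomial (XS n) ℂ) (x : Fin n → ℂ) (s : ℂ) : Prop :=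
  ∀ i : Fin n, eval (evA x s) (pderiv (Sum.inl i) P) = 0

/-- the set of singular points of the compactified fiber `Y_{s,t} ⊂ ℙⁿ`. -/
def SingYst {n : ℕ} (d : ℕ) (P : MvPolynomial (XS n) ℂ) (s t : ℂ) : Set (Prj n) :=
  {p | OnY d P p.rep s t ∧ FiberDerivsVanish d P p.rep s t}

/-- `f₀ = P(·,0)` is a FISI polynomial: it has finitely many critical points, the
projective closure of each of its fibers has only isolated (= finitely many) singular
points, and the singular locus `W₀` of the slice at infinity is finite. -/
def FISIat {n : ℕ} (d : ℕ) (P : MvPolynomial (XS n) ℂ) (s : ℂ) : Prop :=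
  {x : Fin n → ℂ | CritPt P x s}.Finite ∧ (∀ t : ℂ, (SingYst d P s t).Finite) ∧
    (Wset d P s).Finite

/-- `P` is a FISI deformation: `f₀` is FISI, `W₀` is finite and every `f_s`, for `s` in a
neighbourhood of `0`, has only finitely many critical points. -/
def FISIdef {n : ℕ} (d : ℕ) (P : MvPolynomial (XS n) ℂ) : Prop :=
  FISIat d P 0 ∧ ∃ ε > (0:ℝ), ∀ s : ℂ, ‖s‖ < ε → {x : Fin n → ℂ | CritPt P x s}.Finite

/-- The "Milnor-type" local dimension: given polynomial germs `gs` at a point `a ∈ ℂᵐ`,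
this is the `ℂ`-dimension of the formal power series ring at `a` (identified with
`ℂ[[X]]` via `X ↦ X - a`) modulo the ideal generated by the germs. -/
def germDim {m : ℕ} (gs : Set (MvPolynomial (Fin m) ℂ)) (a : Fin m → ℂ) : ℕ :=
  Module.finrank ℂ (MvPowerSeries (Fin m) ℂ ⧸ Ideal.span
    ((fun g => (MvPolynomial.coeToMvPowerSeries.ringHom
        (aeval (fun i => X i + C (a i)) g) : MvPowerSeries (Fin m) ℂ)) '' gs))

/-- the (choice of an) index `j` with `p.rep j ≠ 0`, used to normalize `v_j = 1`
and to work in the chart `x_j = 1` of `ℙⁿ`. -/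
def jp {n : ℕ} (p : PrjInf n) : Fin n :=
  (Function.ne_iff.mp p.rep_nonzero).choose

lemma jp_spec {n : ℕ} (p : PrjInf n) : p.rep (jp p) ≠ 0 :=
  (Function.ne_iff.mp p.rep_nonzero).choose_spec

/-- the chart coordinates of the point at infinity `p = [v:0]`, where `v` is normalized
by `v_{j(p)} = 1`, in the chart `x_{j(p)} = 1` of `ℙⁿ`; the slot `j(p)` of the chart
carries the coordinate `x₀`, which is `0` at `p`. -/
def chartPt {n : ℕ} (p : PrjInf n) : Fin n → ℂ :=
  fun i => if i = jp p then 0 else p.rep i / p.rep (jp p)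

/-- the chart equation of the compactified fiber `Y_{s,t}` in the chart `x_j = 1` of
`ℙⁿ`: substitute `x_j = 1` in the homogeneous defining equation `FY`, the chart slot `j`
carrying the coordinate `x₀`. -/
def chartEq {n : ℕ} (d : ℕ) (P : MvPolynomial (XS n) ℂ) (j : Fin n) (s t : ℂ) :
    MvPolynomial (Fin n) ℂ :=
  aeval (Sum.elim (fun i => if i = j then 1 else X i) ![X j, C s, C t]) (FY d P)

/-- the chart equation of the hypersurface `{P_d(·,s) = 0} ⊂ ℙ^{n-1}` in the chart
`x_j = 1` of `ℙ^{n-1}` (the chart variable `X j` is unused). -/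
def chartEqInf {n : ℕ} (d : ℕ) (P : MvPolynomial (XS n) ℂ) (j : Fin n) (s : ℂ) :
    MvPolynomial (Fin n) ℂ :=
  aeval (fun i => if i = j then 1 else X i) (aeval (Sum.elim X (fun _ => C s)) (xpart P d))

/-- `μ_p(t,s)`, the Milnor number of the isolated singularity of the compactified fiber
`Y_{s,t}` at the point `p` of the hyperplane at infinity. -/
def muP {n : ℕ} (d : ℕ) (P : MvPolynomial (XS n) ℂ) (p : PrjInf n) (s t : ℂ) : ℕ :=
  germDim (Set.range fun i => pderiv i (chartEq d P (jp p) s t)) (chartPt p)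

/-- `μ_{p,gen}(s) = min_{t ∈ ℂ} μ_p(t,s)`. -/
def muGen {n : ℕ} (d : ℕ) (P : MvPolynomial (XS n) ℂ) (p : PrjInf n) (s : ℂ) : ℕ :=
  sInf (Set.range (muP d P p s))

/-- the local Milnor–Lê number `λ_{p,t}(s) = μ_p(t,s) − μ_{p,gen}(s)`. -/
def lamP {n : ℕ} (d : ℕ) (P : MvPolynomial (XS n) ℂ) (p : PrjInf n) (t s : ℂ) : ℕ :=
  muP d P p s t - muGen d P p s

/-- `μ_p^∞(s)`, the Milnor number at `p` of the hypersurface `{P_d(·,s)=0} ⊂ ℙ^{n-1}`: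
computed in the chart `x_{j(p)} = 1`, adding the generator `X (j p)` to kill the unused
chart variable. -/
def muInf {n : ℕ} (d : ℕ) (P : MvPolynomial (XS n) ℂ) (p : PrjInf n) (s : ℂ) : ℕ :=
  germDim ({g | ∃ i, i ≠ jp p ∧ g = pderiv i (chartEqInf d P (jp p) s)} ∪ {X (jp p)})
    (chartPt p)

/-- the total Milnor number `μ(s)` of the affine singularities of `f_s`. -/
def muTot {n : ℕ} (P : MvPolynomial (XS n) ℂ) (s : ℂ) : ℕ :=
  Module.finrank ℂ (MvPolynomial (Fin n) ℂ ⧸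
    Ideal.span (Set.range fun i => pderiv i (fS P s)))

/-- the local Milnor number `μ_a(f_s)` of `f_s` at the point `a ∈ ℂⁿ`. -/
def muAt {n : ℕ} (P : MvPolynomial (XS n) ℂ) (s : ℂ) (a : Fin n → ℂ) : ℕ :=
  germDim (Set.range fun i => pderiv i (fS P s)) a

/-- the total Milnor–Lê number at infinity `λ(s) = Σ_{p ∈ Σ_s} Σ_{t ∈ ℂ} λ_{p,t}(s)`
(all but finitely many summands vanish). -/
def lamTot {n : ℕ} (d : ℕ) (P : MvPolynomial (XS n) ℂ) (s : ℂ) : ℕ :=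
  ∑ᶠ p ∈ Sigset d P s, ∑ᶠ t : ℂ, lamP d P p t s

/-- the chart coordinates of the affine point `[x : 1] ∈ ℙⁿ` in the chart `x_j = 1`,
the slot `j` carrying the coordinate `x₀` (i.e. `1/x_j`). -/
def chartCo {n : ℕ} (j : Fin n) (x : Fin n → ℂ) : Fin n → ℂ :=
  fun i => if i = j then 1 / x j else x i / x j

/-- the affine discriminant `Δ_P ⊂ ℂ_s × ℂ_t`: the closure of the set of pairs
`(s, f_s(x))` over the affine critical points `x` of `f_s`. -/
def DeltaP {n : ℕ} (P : MvPolynomial (XS n) ℂ) : Set (ℂ × ℂ) :=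
  closure {w : ℂ × ℂ | ∃ x : Fin n → ℂ, CritPt P x w.1 ∧ w.2 = eval (evA x w.1) P}

set_option linter.style.haveILetI false
set_option linter.unusedSimpArgs false

lemma exists_deriv {K : Type} [Field K] [Algebra ℂ K] [Algebra.EssFiniteType ℂ K] (s : K)
    (hs : Transcendental ℂ s) : ∃ D : Derivation ℂ K K, D s = 1 := by
  letI : Algebra (Polynomial ℂ) K := (Polynomial.aeval s).toAlgebra
  haveI : IsScalarTower ℂ (Polynomial ℂ) K := IsScalarTower.of_algebraMap_eq (fun r => by
    change _ = Polynomial.aeval s (algebraMap ℂ (Polynomial ℂ) r)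
    simp)
  haveI : FaithfulSMul (Polynomial ℂ) K := by
    rw [faithfulSMul_iff_algebraMap_injective]
    exact transcendental_iff_injective.mp hs
  letI : Algebra (FractionRing (Polynomial ℂ)) K := FractionRing.liftAlgebra _ _
  haveI : IsScalarTower (Polynomial ℂ) (FractionRing (Polynomial ℂ)) K := inferInstance
  haveI : IsScalarTower ℂ (FractionRing (Polynomial ℂ)) K :=
    IsScalarTower.to₁₃₄ ℂ (Polynomial ℂ) (FractionRing (Polynomial ℂ)) K
  haveI : Algebra.EssFiniteType (FractionRing (Polynomial ℂ)) K :=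
    Algebra.EssFiniteType.of_comp ℂ _ _
  haveI : CharZero (FractionRing (Polynomial ℂ)) := inferInstance
  haveI : Algebra.FormallySmooth (FractionRing (Polynomial ℂ)) K := inferInstance
  haveI : Algebra.FormallySmooth (Polynomial ℂ) (FractionRing (Polynomial ℂ)) :=
    Algebra.FormallySmooth.of_isLocalization (nonZeroDivisors (Polynomial ℂ))
  haveI : Algebra.FormallySmooth (Polynomial ℂ) K :=
    Algebra.FormallySmooth.comp _ (FractionRing (Polynomial ℂ)) _
  let φ : Polynomial ℂ →ₐ[ℂ] DualNumber K :=
    Polynomial.aeval (TrivSqZeroExt.inl s + DualNumber.eps)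
  let B := DualNumber K
  letI : CommRing B := inferInstanceAs (CommRing (DualNumber K))
  letI algB : Algebra (Polynomial ℂ) B := φ.toRingHom.toAlgebra
  have hcomp : (TrivSqZeroExt.fstHom ℂ K K).comp φ = Polynomial.aeval s := by
    ext; simp [φ]
  let g : B →ₐ[Polynomial ℂ] K :=
    { (TrivSqZeroExt.fstHom ℂ K K).toRingHom with
      commutes' := fun r => DFunLike.congr_fun hcomp r }
  have hg : Function.Surjective g := fun x => ⟨TrivSqZeroExt.inl x, rfl⟩
  have hker : IsNilpotent (RingHom.ker (g : B →+* K)) := by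
    refine ⟨2, ?_⟩
    rw [pow_two, Ideal.zero_eq_bot, eq_bot_iff, Ideal.mul_le]
    intro a ha b hb
    have ha' : TrivSqZeroExt.fst a = 0 := ha
    have hb' : TrivSqZeroExt.fst b = 0 := hb
    rw [Ideal.mem_bot]
    refine TrivSqZeroExt.ext ?_ ?_
    · change TrivSqZeroExt.fst ((a * b : DualNumber K)) = 0
      rw [TrivSqZeroExt.fst_mul, ha', zero_mul]
    · change TrivSqZeroExt.snd ((a * b : DualNumber K)) = 0
      rw [DualNumber.snd_mul, ha', hb']; simp
  let ψ : K →ₐ[Polynomial ℂ] B :=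
    Algebra.FormallySmooth.liftOfSurjective (AlgHom.id _ K) g hg hker
  have hψ1 : ∀ x, TrivSqZeroExt.fst (ψ x) = x := fun x =>
    Algebra.FormallySmooth.liftOfSurjective_apply (AlgHom.id _ K) g hg hker x
  have hψc : ∀ p : Polynomial ℂ, ψ (Polynomial.aeval s p) = φ p := fun p => ψ.commutes p
  have hψC : ∀ c : ℂ, ψ (algebraMap ℂ K c) = algebraMap ℂ (DualNumber K) c := fun c => by
    have := hψc (Polynomial.C c)
    simpa [φ] using this
  refine ⟨Derivation.mk' { toFun := fun x => TrivSqZeroExt.snd (ψ x), map_add' := ?_, map_smul' := ?_} ?_, ?_⟩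
  · intro x y
    rw [map_add]; rfl
  · intro c x
    rw [Algebra.smul_def, map_mul, hψC]
    change TrivSqZeroExt.snd ((algebraMap ℂ (DualNumber K) c * ψ x : DualNumber K)) = _
    rw [← Algebra.smul_def]; rfl
  · intro x y
    simp only [LinearMap.coe_mk, AddHom.coe_mk]
    rw [map_mul]
    change TrivSqZeroExt.snd ((ψ x * ψ y : DualNumber K)) = _
    rw [DualNumber.snd_mul, hψ1, hψ1]; simp [mul_comm]
  · have := hψc Polynomial.X
    simp only [Polynomial.aeval_X, φ] at this
    simp [this]

lemma deriv_aeval {K σ : Type} [CommRing K] [Algebra ℂ K] [Fintype σ] (D : Derivation ℂ K K)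
    (v : σ → K) (G : MvPolynomial σ ℂ) :
    D (aeval v G) = ∑ i, aeval v (pderiv i G) * D (v i) := by
  classical
  induction G using MvPolynomial.induction_on with
  | C a => simp
  | add p q hp hq => simp [hp, hq, add_mul, Finset.sum_add_distrib]
  | mul_X p j hp =>
    simp only [map_mul, aeval_X, Derivation.leibniz, hp, map_add, smul_eq_mul, add_mul,
      Finset.sum_add_distrib, pderiv_X, Finset.mul_sum]
    congr 1
    · rw [Finset.sum_eq_single j]
      · simp
      · intro b _ hb
        simp [Pi.single_apply, Ne.symm hb]
      · simp
    · exact Finset.sum_congr rfl fun i _ => by ring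

/-- Algebraic replacement of the curve selection lemma. -/
lemma prime_dichotomy {σ : Type} [Fintype σ] (k : σ) (G : MvPolynomial σ ℂ)
    (p : Ideal (MvPolynomial σ ℂ)) [p.IsPrime] (hG : G ∈ p)
    (hd : ∀ i, i ≠ k → pderiv i G ∈ p) :
    (∃ c : ℂ, X k - C c ∈ p) ∨ pderiv k G ∈ p := by
  classical
  let R := MvPolynomial σ ℂ ⧸ p
  let K := FractionRing R
  haveI : Algebra.EssFiniteType R K := Algebra.EssFiniteType.of_isLocalization _ (nonZeroDivisors R)
  haveI : Algebra.EssFiniteType ℂ K := Algebra.EssFiniteType.comp ℂ R K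
  let q : MvPolynomial σ ℂ →ₐ[ℂ] K :=
    (IsScalarTower.toAlgHom ℂ R K).comp (Ideal.Quotient.mkₐ ℂ p)
  have hq : ∀ f, q f = 0 ↔ f ∈ p := by
    intro f
    change algebraMap R K (Ideal.Quotient.mk p f) = 0 ↔ _
    rw [map_eq_zero_iff _ (IsFractionRing.injective R K), Ideal.Quotient.eq_zero_iff_mem]
  have hqa : ∀ f, aeval (fun i => q (X i)) f = q f := by
    intro f
    exact (DFunLike.congr_fun (MvPolynomial.aeval_unique q) f).symm
  by_cases hs : Transcendental ℂ (q (X k))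
  · right
    obtain ⟨D, hD⟩ := exists_deriv _ hs
    have h := deriv_aeval D (fun i => q (X i)) G
    simp only [hqa] at h
    rw [(hq G).2 hG, map_zero, Finset.sum_eq_single k] at h
    · rw [hD, mul_one] at h
      exact (hq _).1 h.symm
    · intro b _ hb
      rw [(hq _).2 (hd b hb), zero_mul]
    · simp
  · left
    have hs' : IsAlgebraic ℂ (q (X k)) := not_not.mp hs
    have hint := hs'.isIntegral
    have hdeg := IsAlgClosed.degree_eq_one_of_irreducible ℂ (minpoly.irreducible hint)
    obtain ⟨c, hc⟩ := minpoly.mem_range_of_degree_eq_one ℂ _ hdeg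
    refine ⟨c, (hq _).1 ?_⟩
    rw [map_sub, sub_eq_zero, ← hc]
    exact (q.commutes c).symm

lemma finite_bad {σ : Type} [Fintype σ] (k : σ) (G : MvPolynomial σ ℂ) :
    ∃ ε > (0:ℝ), ∀ v : σ → ℂ, eval v G = 0 → (∀ i, i ≠ k → eval v (pderiv i G) = 0) →
      0 < ‖v k‖ → ‖v k‖ < ε → eval v (pderiv k G) = 0 := by
  classical
  let I : Ideal (MvPolynomial σ ℂ) := Ideal.span ({G} ∪ {f | ∃ i, i ≠ k ∧ f = pderiv i G})
  have hfin := Ideal.finite_minimalPrimes_of_isNoetherianRing (MvPolynomial σ ℂ) I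
  have hGI : G ∈ I := Ideal.subset_span (Or.inl rfl)
  have hdI : ∀ i, i ≠ k → pderiv i G ∈ I := fun i hi => Ideal.subset_span (Or.inr ⟨i, hi, rfl⟩)
  have key : ∀ p ∈ I.minimalPrimes, ∃ ε > (0:ℝ), ∀ v : σ → ℂ, (∀ f ∈ p, eval v f = 0) →
      0 < ‖v k‖ → ‖v k‖ < ε → eval v (pderiv k G) = 0 := by
    intro p hp
    haveI : p.IsPrime := hp.1.1
    rcases prime_dichotomy k G p (hp.1.2 hGI) (fun i hi => hp.1.2 (hdI i hi)) with ⟨c, hc⟩ | h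
    · by_cases h0 : c = 0
      · refine ⟨1, one_pos, fun v hv h1 _ => ?_⟩
        have := hv _ hc
        simp [h0] at this
        simp [this] at h1
      · refine ⟨‖c‖, norm_pos_iff.2 h0, fun v hv h1 h2 => ?_⟩
        have := hv _ hc
        simp [sub_eq_zero] at this
        simp [this] at h2
    · exact ⟨1, one_pos, fun v hv _ _ => hv _ h⟩
  choose! e he hek using key
  have hev : ∀ᶠ ε in 𝓝[>] (0:ℝ), ∀ p ∈ I.minimalPrimes, ε < e p :=
    (Filter.eventually_all_finite hfin).2 fun p hp =>
      nhdsWithin_le_nhds (eventually_lt_nhds (he p hp))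
  obtain ⟨ε, h1, h2⟩ := (hev.and self_mem_nhdsWithin).exists
  refine ⟨ε, h2, fun v hv hvd hpos hlt => ?_⟩
  have hI : I ≤ RingHom.ker (eval v) := by
    rw [Ideal.span_le]
    rintro f (hf | ⟨i, hi, rfl⟩)
    · rw [Set.mem_singleton_iff.1 hf]; exact hv
    · exact hvd i hi
  haveI : (RingHom.ker (eval v)).IsPrime := RingHom.ker_isPrime _
  obtain ⟨p, hp, hpl⟩ := Ideal.exists_minimalPrimes_le hI
  exact hek p hp v (fun f hf => hpl hf) hpos (hlt.trans (h1 p hp))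

lemma pderiv_embT {n : ℕ} (v : TV n) (Q : MvPolynomial (XS n) ℂ) :
    pderiv v (aeval (embT (n := n)) Q) =
      ∑ j, aeval embT (pderiv j Q) * pderiv v (embT j) :=
  deriv_aeval (pderiv v) embT Q

lemma pderiv_embT_x {n : ℕ} (i : Fin n) (Q : MvPolynomial (XS n) ℂ) :
    pderiv (Sum.inl i : TV n) (aeval (embT (n := n)) Q) = aeval embT (pderiv (Sum.inl i) Q) := by
  classical
  rw [pderiv_embT, Finset.sum_eq_single (Sum.inl i)]
  · simp [embT]
  · rintro (b | b) _ hb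
    · have : b ≠ i := fun h => hb (by rw [h])
      simp [embT, pderiv_X, Pi.single_apply, this]
    · simp [embT, pderiv_X, Pi.single_apply]
  · simp

lemma pderiv_embT_s {n : ℕ} (Q : MvPolynomial (XS n) ℂ) :
    pderiv (Sum.inr 1 : TV n) (aeval (embT (n := n)) Q) = aeval embT (pderiv (Sum.inr ()) Q) := by
  classical
  rw [pderiv_embT, Finset.sum_eq_single (Sum.inr ())]
  · simp [embT]
  · rintro (b | b) _ hb
    · simp [embT, pderiv_X, Pi.single_apply]
    · exact absurd rfl hb
  · simp

lemma pderiv_embT_zero {n : ℕ} (k : Fin 3) (hk : k ≠ 1) (Q : MvPolynomial (XS n) ℂ) :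
    pderiv (Sum.inr k : TV n) (aeval (embT (n := n)) Q) = 0 := by
  classical
  rw [pderiv_embT]
  refine Finset.sum_eq_zero ?_
  rintro (b | b) _
  · simp [embT, pderiv_X, Pi.single_apply]
  · simp [embT, pderiv_X, Pi.single_apply, hk.symm]

lemma eval_embT {n : ℕ} (u : HV n → ℂ) (s t : ℂ) (Q : MvPolynomial (XS n) ℂ) :
    eval (evT u s t) (aeval (embT (n := n)) Q) = eval (evA (fun i => u (Sum.inl i)) s) Q := by
  induction Q using MvPolynomial.induction_on with
  | C a => simp
  | add p q hp hq => rw [map_add, map_add, map_add, hp, hq]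
  | mul_X p j hp =>
    rw [map_mul, map_mul, map_mul, hp]
    congr 1
    rcases j with j | j <;> simp [embT, evT, evA]

lemma eval_dt {n : ℕ} (d : ℕ) (P : MvPolynomial (XS n) ℂ) (u : HV n → ℂ) (s t : ℂ) :
    eval (evT u s t) (pderiv (Sum.inr 2) (FY d P)) = - u (Sum.inr ()) ^ d := by
  classical
  have h : (pderiv (Sum.inr 2 : TV n)) (FY d P) = - X (Sum.inr 0) ^ d := by
    have hX : pderiv (Sum.inr 2 : TV n) (X (Sum.inr 0) : MvPolynomial (TV n) ℂ) = 0 :=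
      pderiv_X_of_ne (by simp)
    simp only [FY, map_sub, map_sum, Derivation.leibniz, Derivation.leibniz_pow, hX,
      pderiv_embT_zero 2 (by decide), pderiv_X_self, smul_eq_mul, mul_zero, mul_one, nsmul_zero,
      add_zero, zero_add, Finset.sum_const_zero, zero_sub]
  rw [h]
  simp [evT]

lemma sum_top {d : ℕ} (f : ℕ → ℂ) :
    ∑ q ∈ Finset.range (d+1), (0:ℂ)^(d-q) * f q = f d := by
  rw [Finset.sum_eq_single d]
  · simp
  · intro b hb hbd
    have : d - b ≠ 0 := by have := Finset.mem_range.1 hb; omega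
    simp [this]
  · simp

lemma eval_FY {n : ℕ} {d : ℕ} (hd : 2 ≤ d) (P : MvPolynomial (XS n) ℂ) (u : HV n → ℂ)
    (hu : u (Sum.inr ()) = 0) (s t : ℂ) :
    eval (evT u s t) (FY d P) = eval (evA (fun i => u (Sum.inl i)) s) (xpart P d) := by
  have h0 : evT u s t (Sum.inr 0) = 0 := by simp [evT, hu]
  have hd0 : d ≠ 0 := by omega
  simp only [FY, map_sub, map_sum, map_mul, map_pow, eval_X, h0, eval_embT, sum_top]
  simp [hd0]

lemma eval_dx {n : ℕ} {d : ℕ} (hd : 2 ≤ d) (P : MvPolynomial (XS n) ℂ) (u : HV n → ℂ)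
    (hu : u (Sum.inr ()) = 0) (s t : ℂ) (i : Fin n) :
    eval (evT u s t) (pderiv (Sum.inl i) (FY d P)) =
      eval (evA (fun i => u (Sum.inl i)) s) (pderiv (Sum.inl i) (xpart P d)) := by
  classical
  have h0 : evT u s t (Sum.inr 0) = 0 := by simp [evT, hu]
  have hd0 : d ≠ 0 := by omega
  have hX : ∀ k : Fin 3, pderiv (Sum.inl i : TV n) (X (Sum.inr k) : MvPolynomial (TV n) ℂ) = 0 :=
    fun k => pderiv_X_of_ne (by simp)
  simp only [FY, map_sub, map_sum, Derivation.leibniz, Derivation.leibniz_pow, hX, pderiv_embT_x,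
    nsmul_zero, mul_zero, add_zero, smul_eq_mul, map_mul, map_pow, eval_X, h0, eval_embT, sum_top,
    map_zero, sub_zero]

lemma eval_ds {n : ℕ} {d : ℕ} (hd : 2 ≤ d) (P : MvPolynomial (XS n) ℂ) (u : HV n → ℂ)
    (hu : u (Sum.inr ()) = 0) (s t : ℂ) :
    eval (evT u s t) (pderiv (Sum.inr 1) (FY d P)) =
      eval (evA (fun i => u (Sum.inl i)) s) (pderiv (Sum.inr ()) (xpart P d)) := by
  classical
  have h0 : evT u s t (Sum.inr 0) = 0 := by simp [evT, hu]
  have hd0 : d ≠ 0 := by omega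
  have hX : ∀ k : Fin 3, k ≠ 1 →
      pderiv (Sum.inr 1 : TV n) (X (Sum.inr k) : MvPolynomial (TV n) ℂ) = 0 :=
    fun k hk => pderiv_X_of_ne (by simpa using hk)
  simp only [FY, map_sub, map_sum, Derivation.leibniz, Derivation.leibniz_pow,
    hX 0 (by decide), hX 2 (by decide), pderiv_embT_s,
    smul_zero, add_zero, smul_eq_mul, map_mul, map_pow, eval_X, h0, eval_embT, sum_top, sub_zero,
    mul_zero, map_zero]

lemma eval_dx0 {n : ℕ} {d : ℕ} (hd : 2 ≤ d) (P : MvPolynomial (XS n) ℂ) (u : HV n → ℂ)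
    (hu : u (Sum.inr ()) = 0) (s t : ℂ) :
    eval (evT u s t) (pderiv (Sum.inr 0) (FY d P)) =
      eval (evA (fun i => u (Sum.inl i)) s) (xpart P (d-1)) := by
  classical
  have h0 : evT u s t (Sum.inr 0) = 0 := by simp [evT, hu]
  have hd0 : d - 1 ≠ 0 := by omega
  have hX : pderiv (Sum.inr 0 : TV n) (X (Sum.inr 2) : MvPolynomial (TV n) ℂ) = 0 :=
    pderiv_X_of_ne (by simp)
  simp only [FY, map_sub, map_sum, Derivation.leibniz, Derivation.leibniz_pow,
    hX, pderiv_embT_zero 0 (by decide), pderiv_X_self,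
    smul_zero, add_zero, zero_add, smul_eq_mul, map_mul, map_pow, eval_X, h0, eval_embT,
    mul_one, nsmul_eq_mul, map_natCast, mul_zero]
  rw [Finset.sum_eq_single (d-1)]
  · have : d - (d - 1) = 1 := by omega
    simp [this, hd0]
  · intro b hb hbd
    have hb' := Finset.mem_range.1 hb
    by_cases hbd' : b = d
    · simp [hbd']
    · have : d - b - 1 ≠ 0 := by omega
      simp [this]
  · intro h
    exact absurd (Finset.mem_range.2 (by omega)) h

lemma xpart_wh {n : ℕ} (P : MvPolynomial (XS n) ℂ) (q : ℕ) :
    (xpart P q).IsWeightedHomogeneous (wtx n) q :=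
  weightedHomogeneousComponent_isWeightedHomogeneous q P

lemma euler_zero {n : ℕ} {d : ℕ} (hd : 2 ≤ d) (P : MvPolynomial (XS n) ℂ) (x : Fin n → ℂ) (s : ℂ)
    (h : WCond d P x s) : eval (evA x s) (xpart P d) = 0 := by
  have := congrArg (eval (evA x s)) (xpart_wh P d).sum_weight_X_mul_pderiv
  have hd0 : d ≠ 0 := by omega
  have h' : ∀ i, eval (evA x s) (pderiv (Sum.inl i) (xpart P d)) = 0 := h
  simpa [wtx, h', hd0] using this

lemma slice_iff {n : ℕ} {d : ℕ} (hd : 2 ≤ d) (P : MvPolynomial (XS n) ℂ) (u : HV n → ℂ)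
    (s t : ℂ) : (OnY d P u s t ∧ SliceDerivsVanish d P u s t) ↔
      (u (Sum.inr ()) = 0 ∧ SCond d P (fun i => u (Sum.inl i)) s) := by
  have hd0 : d ≠ 0 := by omega
  constructor
  · rintro ⟨_, ⟨h1, h2⟩, h3⟩
    rw [eval_dt, neg_eq_zero, pow_eq_zero_iff hd0] at h3
    refine ⟨h3, fun i => ?_, ?_⟩
    · rw [← eval_dx hd P u h3 s t]; exact h1 i
    · rw [← eval_dx0 hd P u h3 s t]; exact h2
  · rintro ⟨h3, h1, h2⟩
    refine ⟨?_, ⟨fun i => ?_, ?_⟩, ?_⟩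
    · rw [OnY, eval_FY hd P u h3]; exact euler_zero hd P _ _ h1
    · rw [eval_dx hd P u h3 s t]; exact h1 i
    · rw [eval_dx0 hd P u h3 s t]; exact h2
    · rw [eval_dt, h3]; simp [hd0]

lemma all_iff {n : ℕ} {d : ℕ} (hd : 2 ≤ d) (P : MvPolynomial (XS n) ℂ) (u : HV n → ℂ)
    (s t : ℂ) : (OnY d P u s t ∧ AllDerivsVanish d P u s t) ↔
      (u (Sum.inr ()) = 0 ∧ SCond d P (fun i => u (Sum.inl i)) s ∧
        eval (evA (fun i => u (Sum.inl i)) s) (pderiv (Sum.inr ()) (xpart P d)) = 0) := by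
  constructor
  · rintro ⟨h, hA⟩
    have := (slice_iff hd P u s t).1 ⟨h, ⟨fun i => hA _, hA _⟩, hA _⟩
    refine ⟨this.1, this.2, ?_⟩
    rw [← eval_ds hd P u this.1 s t]; exact hA _
  · rintro ⟨h1, h2, h3⟩
    obtain ⟨h, ⟨ha, hb⟩, hc⟩ := (slice_iff hd P u s t).2 ⟨h1, h2⟩
    refine ⟨h, ?_⟩
    rintro (i | k)
    · exact ha i
    · fin_cases k
      · exact hb
      · change eval (evT u s t) (pderiv (Sum.inr 1) (FY d P)) = 0
        rw [eval_ds hd P u h1 s t]; exact h3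
      · exact hc

lemma eval_scale {n : ℕ} (c : ℂ) (x : Fin n → ℂ) (s : ℂ) (q : ℕ) (Q : MvPolynomial (XS n) ℂ)
    (hQ : Q.IsWeightedHomogeneous (wtx n) q) :
    eval (evA (c • x) s) Q = c ^ q * eval (evA x s) Q := by
  induction hQ using IsWeightedHomogeneous.induction_on with
  | zero => simp
  | add p q hp hq h1 h2 => simp [h1, h2, mul_add]
  | monomial m r hr =>
    rw [← hr, eval_monomial, eval_monomial, Finsupp.weight_apply,
      Finsupp.prod_fintype _ _ (by simp), Finsupp.prod_fintype _ _ (by simp),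
      Finsupp.sum_fintype _ _ (by simp)]
    simp [evA, wtx, mul_pow, Finset.prod_mul_distrib, Finset.prod_pow_eq_pow_sum]
    ring

lemma cond_scale {n : ℕ} {d : ℕ} (hd : 2 ≤ d) (P : MvPolynomial (XS n) ℂ) (x : Fin n → ℂ) (s c : ℂ)
    (h : SCond d P x s ∧ eval (evA x s) (pderiv (Sum.inr ()) (xpart P d)) = 0) :
    SCond d P (c • x) s ∧ eval (evA (c • x) s) (pderiv (Sum.inr ()) (xpart P d)) = 0 := by
  obtain ⟨⟨h1, h2⟩, h3⟩ := h
  refine ⟨⟨fun i => ?_, ?_⟩, ?_⟩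
  · rw [eval_scale c x s (d-1) _ ((xpart_wh P d).pderiv (by simp [wtx]; omega)), h1 i, mul_zero]
  · rw [eval_scale c x s _ _ (xpart_wh P (d-1)), h2, mul_zero]
  · rw [eval_scale c x s d _ ((xpart_wh P d).pderiv (by simp [wtx])), h3, mul_zero]

lemma cont_eval {n : ℕ} (Q : MvPolynomial (XS n) ℂ) :
    Continuous (fun w : (Fin n → ℂ) × ℂ => eval (evA w.1 w.2) Q) := by
  refine (MvPolynomial.continuous_eval Q).comp (continuous_pi ?_)
  rintro (i | i)
  · exact (continuous_apply i).comp continuous_fst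
  · exact continuous_snd

lemma compactness {n : ℕ} {d : ℕ} (hd : 2 ≤ d) (P : MvPolynomial (XS n) ℂ)
    (h : ¬ ∃ x : Fin n → ℂ, x ≠ 0 ∧ SCond d P x 0 ∧ PhiCond d P x) :
    ∃ ε > (0:ℝ), ∀ s : ℂ, ‖s‖ < ε → ∀ x : Fin n → ℂ, x ≠ 0 →
      ¬ (SCond d P x s ∧ eval (evA x s) (pderiv (Sum.inr ()) (xpart P d)) = 0) := by
  let Z : Set ((Fin n → ℂ) × ℂ) := (Metric.sphere 0 1 ×ˢ Metric.closedBall 0 1) ∩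
    {w | SCond d P w.1 w.2 ∧ eval (evA w.1 w.2) (pderiv (Sum.inr ()) (xpart P d)) = 0}
  have hZ : IsCompact Z := by
    refine ((isCompact_sphere _ _).prod (isCompact_closedBall _ _)).inter_right ?_
    simp only [SCond, WCond, Set.ofPred_and, Set.ofPred_forall]
    exact ((isClosed_iInter fun i => isClosed_eq (cont_eval _) continuous_const).inter
      (isClosed_eq (cont_eval _) continuous_const)).inter
      (isClosed_eq (cont_eval _) continuous_const)
  have main : ∃ ε > (0:ℝ), ∀ w ∈ Z, ε ≤ ‖w.2‖ := by
    rcases Z.eq_empty_or_nonempty with hE | hN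
    · exact ⟨1, one_pos, by simp [hE]⟩
    · obtain ⟨w, hw, hmin⟩ := hZ.exists_isMinOn hN (f := fun w => ‖w.2‖)
        (continuous_snd.norm.continuousOn)
      refine ⟨‖w.2‖, norm_pos_iff.2 fun h0 => h ⟨w.1, ?_, ?_, ?_⟩, fun v hv => hmin hv⟩
      · intro hw0
        have := hw.1.1
        simp [hw0] at this
      · rw [← h0]; exact hw.2.1
      · have h3 := hw.2.2
        rw [h0] at h3; exact h3
  obtain ⟨ε, hε, hm⟩ := main
  refine ⟨min ε 1, lt_min hε one_pos, fun s hs x hx hc => ?_⟩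
  have hx' : ‖x‖ ≠ 0 := norm_ne_zero_iff.2 hx
  have := hm (((‖x‖⁻¹ : ℝ) : ℂ) • x, s) ⟨⟨?_, ?_⟩, cond_scale hd P x s _ hc⟩
  · exact absurd (hs.trans_le (min_le_left _ _)) (not_lt.2 this)
  · simp [norm_smul, hx']
  · simpa using (hs.trans_le (min_le_right _ _)).le

/-- For a one-parameter deformation of a FISI polynomial `f₀`:
`Y` has no singular point with `|s| < ε` iff `Σ₀ ∩ {φ_d = 0} = ∅`; and in this case the
critical points of `σ : Y → ℂ_s` with `|s| < ε` are exactly `Σ₀ × {0} × ℂ`; in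
particular `Σ_s = ∅` for `0 < |s| < ε`. -/
theorem stmt2 {n d : ℕ} (hn : 2 ≤ n) (hd : 2 ≤ d) (P : MvPolynomial (XS n) ℂ)
    (hdeg : ∃ ε > (0:ℝ), ∀ s : ℂ, ‖s‖ < ε → DegXAt d P s)
    (hfisi : FISIat d P 0) :
    ((∃ ε > (0:ℝ), ∀ (u : HV n → ℂ), u ≠ 0 → ∀ s t : ℂ, ‖s‖ < ε →
        ¬ (OnY d P u s t ∧ AllDerivsVanish d P u s t)) ↔
      ¬ ∃ x : Fin n → ℂ, x ≠ 0 ∧ SCond d P x 0 ∧ PhiCond d P x) ∧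
    ((¬ ∃ x : Fin n → ℂ, x ≠ 0 ∧ SCond d P x 0 ∧ PhiCond d P x) →
      ∃ ε > (0:ℝ),
        (∀ (u : HV n → ℂ), u ≠ 0 → ∀ s t : ℂ, ‖s‖ < ε →
          ((OnY d P u s t ∧ SliceDerivsVanish d P u s t) ↔
            (s = 0 ∧ u (Sum.inr ()) = 0 ∧ SCond d P (fun i => u (Sum.inl i)) 0))) ∧
        (∀ s : ℂ, 0 < ‖s‖ → ‖s‖ < ε → ∀ x : Fin n → ℂ, x ≠ 0 → ¬ SCond d P x s)) := by
  have hne : ∀ u : HV n → ℂ, u ≠ 0 → u (Sum.inr ()) = 0 → (fun i => u (Sum.inl i)) ≠ 0 := by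
    intro u hu h0 hx
    refine hu (funext ?_)
    rintro (i | i)
    · exact congrFun hx i
    · exact h0
  constructor
  · constructor
    · rintro ⟨ε, hε, H⟩ ⟨x, hx, h1, h2⟩
      refine H (Sum.elim x (fun _ => 0)) (fun h => hx (funext fun i => congrFun h (Sum.inl i)))
        0 0 (by simpa using hε) ((all_iff hd P _ 0 0).2 ⟨rfl, h1, h2⟩)
    · intro h
      obtain ⟨ε, hε, H⟩ := compactness hd P h
      refine ⟨ε, hε, fun u hu s t hs hc => ?_⟩
      obtain ⟨h0, h1⟩ := (all_iff hd P u s t).1 hc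
      exact H s hs _ (hne u hu h0) h1
  · intro h
    obtain ⟨ε₁, hε₁, H₁⟩ := compactness hd P h
    obtain ⟨ε₂, hε₂, H₂⟩ := finite_bad (Sum.inr () : XS n) (xpart P d)
    have key : ∀ s : ℂ, 0 < ‖s‖ → ‖s‖ < min ε₁ ε₂ → ∀ x : Fin n → ℂ, x ≠ 0 →
        ¬ SCond d P x s := by
      intro s h0 hs x hx hc
      refine H₁ s (hs.trans_le (min_le_left _ _)) x hx ⟨hc, ?_⟩
      refine H₂ (evA x s) (euler_zero hd P x s hc.1) ?_ h0 (hs.trans_le (min_le_right _ _))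
      rintro (i | i) hi
      · exact hc.1 i
      · exact absurd rfl hi
    refine ⟨min ε₁ ε₂, lt_min hε₁ hε₂, fun u hu s t hs => ?_, key⟩
    rw [slice_iff hd]
    constructor
    · rintro ⟨h0, h1⟩
      have hs0 : s = 0 := by
        by_contra hs0
        exact key s (norm_pos_iff.2 hs0) hs _ (hne u hu h0) h1
      subst hs0
      exact ⟨rfl, h0, h1⟩
    · rintro ⟨rfl, h0, h1⟩
      exact ⟨h0, h1⟩
end
end

section
/- Let P be any one-parameter deformation of a FISI polynomial f₀ of degree d ≥ 2. Consider Y^∞ := {([x], s, t) ∈ ℙ^{n−1} × ℂ × ℂ : P_d(x,s) = 0}. Then there exists ε > 0 such that Y^∞ has no singular point with |s| < ε if and only if W₀ ∩ {φ_d = 0} = ∅ (i.e. there is no [x] ∈ ℙ^{n−1} with ∂P_d/∂x_i(x,0) = 0 for all i and ∂P_d/∂s(x,0) = 0). In this case, after possibly shrinking ε, the set of critical points of the projection σ : Y^∞ → ℂ to the s-coordinate lying in {|s| < ε} — namely the points of Y^∞ at which ∂P_d/∂x_i(x,s) = 0 for all i = 1,…,n — is exactly W₀ × {0} × ℂ;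 in particular W_s = ∅ for 0 < |s| < ε. -/
open MvPolynomial Filter CategoryTheory Limits Topology

noncomputable section

section Helpers

open scoped Polynomial TensorProduct

lemma h_D_ne_zero {L : Type} [Field L] [Algebra ℂ L] [Algebra ℂ[X] L] [IsScalarTower ℂ ℂ[X] L]
    [FaithfulSMul ℂ[X] L] [Algebra.EssFiniteType ℂ[X] L] :
    KaehlerDifferential.D ℂ L (algebraMap ℂ[X] L Polynomial.X) ≠ 0 := by
  let : Algebra (FractionRing ℂ[X]) L := FractionRing.liftAlgebra ℂ[X] L
  have : IsScalarTower ℂ[X] (FractionRing ℂ[X]) L := FractionRing.isScalarTower_liftAlgebra ℂ[X] L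
  have : CharZero (FractionRing ℂ[X]) :=
    charZero_of_injective_algebraMap (R := ℂ) (FaithfulSMul.algebraMap_injective _ _)
  have : Algebra.EssFiniteType (FractionRing ℂ[X]) L := Algebra.EssFiniteType.of_comp ℂ[X] _ _
  have : Algebra.FormallySmooth ℂ[X] (FractionRing ℂ[X]) :=
    Algebra.FormallySmooth.of_isLocalization (nonZeroDivisors ℂ[X])
  have : Algebra.FormallySmooth ℂ[X] L := Algebra.FormallySmooth.comp ℂ[X] (FractionRing ℂ[X]) L
  intro h
  have h1 : KaehlerDifferential.mapBaseChange ℂ ℂ[X] L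
      (1 ⊗ₜ KaehlerDifferential.D ℂ ℂ[X] Polynomial.X) = 0 := by
    simpa using h
  obtain ⟨y, hy⟩ := (Algebra.H1Cotangent.exact_δ_mapBaseChange ℂ ℂ[X] L _).mp h1
  rw [Subsingleton.elim y 0, map_zero] at hy
  have h2 := congrArg (LinearMap.lTensor L (KaehlerDifferential.polynomialEquiv ℂ).toLinearMap) hy
  have h3 := congrArg (TensorProduct.rid ℂ[X] L) h2
  simp [KaehlerDifferential.polynomialEquiv_D] at h3

lemma h_chain {σ A M : Type*} [Fintype σ] [CommRing A] [Algebra ℂ A] [AddCommGroup M]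
    [Module A M] [Module ℂ M] [IsScalarTower ℂ A M] (D : Derivation ℂ A M) (a : σ → A)
    (G : MvPolynomial σ ℂ) :
    D (aeval a G) = ∑ v, aeval a (pderiv v G) • D (a v) := by
  classical
  induction G using MvPolynomial.induction_on with
  | C c => simp [aeval_C]
  | add p q hp hq => simp [hp, hq, add_smul, Finset.sum_add_distrib]
  | mul_X p i hp =>
    simp only [map_mul, aeval_X, Derivation.leibniz, hp, map_add, smul_eq_mul, add_smul,
      Finset.sum_add_distrib, pderiv_X, Finset.smul_sum, mul_smul]
    congr 1
    rw [Finset.sum_eq_single i]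
    · simp
    · intro b _ hb
      simp [Pi.single_apply, hb.symm]
    · simp

/-- regard a polynomial in `(x,s)` as a polynomial in `x` over `ℂ[s]`. -/
def hE {n : ℕ} (G : MvPolynomial (XS n) ℂ) : MvPolynomial (Fin n) ℂ[X] :=
  aeval (Sum.elim X (fun _ => C Polynomial.X)) G

lemma hE_aeval {n : ℕ} {L : Type*} [CommRing L] [Algebra ℂ L] [Algebra ℂ[X] L]
    [IsScalarTower ℂ ℂ[X] L] (x : Fin n → L) (G : MvPolynomial (XS n) ℂ) :
    aeval x (hE G) = aeval (Sum.elim x (fun _ => algebraMap ℂ[X] L Polynomial.X) : XS n → L) G := by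
  have : ((aeval x : MvPolynomial (Fin n) ℂ[X] →ₐ[ℂ[X]] L).restrictScalars ℂ).comp
      (aeval (Sum.elim X (fun _ => C Polynomial.X) : XS n → MvPolynomial (Fin n) ℂ[X])) =
      aeval (Sum.elim x (fun _ => algebraMap ℂ[X] L Polynomial.X) : XS n → L) := by
    ext v
    rcases v with v | v <;> simp
  exact DFunLike.congr_fun this G

lemma hE_eval {n : ℕ} (x : Fin n → ℂ) (s : ℂ) (G : MvPolynomial (XS n) ℂ) :
    eval₂Hom (Polynomial.evalRingHom s) x (hE G) = eval (evA x s) G := by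
  induction G using MvPolynomial.induction_on with
  | C c => simp [hE, aeval_C, IsScalarTower.algebraMap_apply ℂ ℂ[X] (MvPolynomial (Fin n) ℂ[X]),
      algebraMap_eq]
  | add p q hp hq => simp only [hE, map_add] at *; rw [hp, hq]
  | mul_X p i hp =>
    simp only [hE, map_mul] at *; rw [hp]
    rcases i with i | i <;> simp [evA]

lemma hE_hom {n q : ℕ} (G : MvPolynomial (XS n) ℂ) (hG : IsWeightedHomogeneous (wtx n) G q) :
    (hE G).IsHomogeneous q := by
  classical
  rw [hE, G.as_sum, map_sum]
  refine IsHomogeneous.sum _ _ _ fun m hm => ?_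
  have hw := hG (mem_support_iff.mp hm)
  rw [aeval_monomial, Finsupp.prod_fintype _ _ (by simp), Fintype.prod_sum_type]
  have hw' : 0 + (∑ i : Fin n, m (Sum.inl i) + 0) = q := by
    rw [← hw, Finsupp.weight_apply, Finsupp.sum_fintype _ _ (by simp), Fintype.sum_sum_type]
    simp [wtx]
  rw [← hw']
  refine IsHomogeneous.mul ?_ (IsHomogeneous.mul ?_ ?_)
  · rw [IsScalarTower.algebraMap_apply ℂ ℂ[X] (MvPolynomial (Fin n) ℂ[X]), algebraMap_eq]
    exact isHomogeneous_C _ _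
  · refine IsHomogeneous.prod _ _ _ fun i _ => ?_
    simpa using (isHomogeneous_X ℂ[X] i).pow (m (Sum.inl i))
  · simp only [Finset.univ_unique, Finset.prod_singleton, Sum.elim_inr, ← map_pow]
    exact isHomogeneous_C _ _

attribute [local instance] MvPolynomial.gradedAlgebra

lemma h_nak {n : ℕ} {ι : Type*} (F : ι → MvPolynomial (Fin n) ℂ[X]) (deg : ι → ℕ)
    (hF : ∀ k, (F k).IsHomogeneous (deg k))
    (h0 : ∀ x : Fin n → ℂ, x ≠ 0 → ∃ k, eval₂Hom (Polynomial.evalRingHom 0) x (F k) ≠ 0) :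
    ∃ h : ℂ[X], h.eval 0 ≠ 0 ∧ ∃ N, ∀ j, C h * X j ^ N ∈ Ideal.span (Set.range F) := by
  classical
  let ρ : ℂ[X] →+* ℂ := Polynomial.evalRingHom 0
  let I := Ideal.span (Set.range F)
  let I0 : Ideal (MvPolynomial (Fin n) ℂ) := I.map (MvPolynomial.map ρ)
  have hhom : I.IsHomogeneous (homogeneousSubmodule (Fin n) ℂ[X]) := by
    apply Ideal.homogeneous_span
    rintro _ ⟨k, rfl⟩
    exact ⟨deg k, hF k⟩
  have hrad : idealOfVars (Fin n) ℂ ≤ I0.radical := by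
    rw [← vanishingIdeal_zeroLocus_eq_radical (K := ℂ), idealOfVars, Ideal.span_le]
    rintro _ ⟨j, rfl⟩
    simp only [SetLike.mem_coe, mem_vanishingIdeal_iff]
    intro x hx
    by_cases hx0 : x = 0
    · simp [hx0]
    · exfalso
      obtain ⟨k, hk⟩ := h0 x hx0
      apply hk
      have := hx (MvPolynomial.map ρ (F k)) (Ideal.mem_map_of_mem _ (Ideal.subset_span ⟨k, rfl⟩))
      rw [aeval_def, eval₂_map] at this
      simpa using this
  obtain ⟨M, hM⟩ := Ideal.exists_pow_le_of_le_radical_of_fg hrad (idealOfVars_fg _ _)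
  have key : homogeneousSubmodule (Fin n) ℂ[X] M ≤ I.restrictScalars ℂ[X] ⊔
      (Ideal.span {(Polynomial.X : ℂ[X])}) • homogeneousSubmodule (Fin n) ℂ[X] M := by
    intro p hp
    have h1 : MvPolynomial.map ρ p ∈ I0 := by
      apply hM
      rw [mem_pow_idealOfVars_iff']
      intro x hx
      have : coeff x (MvPolynomial.map ρ p) = 0 := by
        rw [coeff_map, IsHomogeneous.coeff_eq_zero hp (by omega), map_zero]
      exact this
    have hsurj : Function.Surjective (MvPolynomial.map ρ : MvPolynomial (Fin n) ℂ[X] →+* _) :=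
      MvPolynomial.map_surjective ρ (fun c => ⟨Polynomial.C c, by simp [ρ]⟩)
    obtain ⟨q, hq, hqp⟩ := (Ideal.mem_map_iff_of_surjective _ hsurj).mp h1
    have h2 : p - q ∈ RingHom.ker (MvPolynomial.map ρ : MvPolynomial (Fin n) ℂ[X] →+* _) := by
      rw [RingHom.mem_ker, map_sub, hqp, sub_self]
    rw [MvPolynomial.ker_map, mem_map_C_iff] at h2
    have hdvd : C (Polynomial.X : ℂ[X]) ∣ p - q := by
      rw [C_dvd_iff_dvd_coeff]
      intro m
      have := h2 m
      rw [RingHom.mem_ker] at this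
      exact Polynomial.X_dvd_iff.mpr (by simpa [ρ, Polynomial.coeff_zero_eq_eval_zero] using this)
    obtain ⟨r, hr⟩ := hdvd
    have hp' : p = homogeneousComponent M q + (Polynomial.X : ℂ[X]) • homogeneousComponent M r := by
      have : p = q + (Polynomial.X : ℂ[X]) • r := by
        rw [smul_eq_C_mul, ← hr]; ring
      have h4 : homogeneousComponent M p = p := by
        rw [homogeneousComponent_of_mem hp, if_pos rfl]
      conv_lhs => rw [← h4, this]
      simp
    rw [hp']
    refine Submodule.add_mem_sup ?_ ?_
    · exact homogeneousComponent_mem_of_mem hhom hq M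
    · exact Submodule.smul_mem_smul (Ideal.subset_span rfl) (homogeneousComponent_mem M r)
  obtain ⟨h, hh, hle⟩ := Submodule.exists_sub_one_mem_and_smul_le_of_fg_of_le_sup
    (homogeneousSubmodule_fg _ _ M) le_rfl key
  refine ⟨h, ?_, M, fun j => ?_⟩
  · rw [Ideal.mem_span_singleton, Polynomial.X_dvd_iff, Polynomial.coeff_zero_eq_eval_zero] at hh
    simp only [Polynomial.eval_sub, Polynomial.eval_one, sub_eq_zero] at hh
    simp [hh]
  · rw [← smul_eq_C_mul]
    apply hle
    refine Submodule.smul_mem_pointwise_smul _ _ _ ?_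
    simpa using (isHomogeneous_X ℂ[X] j).pow M

lemma h_gen_aux {n : ℕ} {ι : Type*} (F : ι → MvPolynomial (Fin n) ℂ[X]) (j : Fin n)
    (hL : ∀ (L : Type) [Field L] [Algebra ℂ L] [Algebra ℂ[X] L] [IsScalarTower ℂ ℂ[X] L]
      [FaithfulSMul ℂ[X] L] [Algebra.EssFiniteType ℂ[X] L] (x : Fin n → L),
      (∀ k, aeval x (F k) = 0) → x j = 0)
    {A : Type} [CommRing A] [IsDomain A] [Algebra ℂ A] [Algebra ℂ[X] A] [IsScalarTower ℂ ℂ[X] A]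
    [Algebra.EssFiniteType ℂ[X] A] (hinj : Function.Injective (algebraMap ℂ[X] A))
    (π : MvPolynomial (Fin n) ℂ[X] →ₐ[ℂ[X]] A) (hπ : ∀ k, π (F k) = 0) : π (X j) = 0 := by
  have : FaithfulSMul ℂ[X] (FractionRing A) := by
    rw [faithfulSMul_iff_algebraMap_injective, IsScalarTower.algebraMap_eq ℂ[X] A (FractionRing A)]
    exact (IsFractionRing.injective A (FractionRing A)).comp hinj
  have : Algebra.EssFiniteType A (FractionRing A) :=
    Algebra.EssFiniteType.of_isLocalization (FractionRing A) (nonZeroDivisors A)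
  have : Algebra.EssFiniteType ℂ[X] (FractionRing A) :=
    Algebra.EssFiniteType.comp ℂ[X] A (FractionRing A)
  have hx : aeval (fun i => algebraMap A (FractionRing A) (π (X i))) =
      (IsScalarTower.toAlgHom ℂ[X] A (FractionRing A)).comp π := by
    ext i
    simp
  have h := hL (FractionRing A) (fun i => algebraMap A (FractionRing A) (π (X i))) (fun k => by
    rw [hx, AlgHom.comp_apply, hπ, map_zero])
  exact (map_eq_zero_iff _ (IsFractionRing.injective A (FractionRing A))).mp h

lemma h_gen {n : ℕ} {ι : Type*} (F : ι → MvPolynomial (Fin n) ℂ[X]) (j : Fin n)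
    (hL : ∀ (L : Type) [Field L] [Algebra ℂ L] [Algebra ℂ[X] L] [IsScalarTower ℂ ℂ[X] L]
      [FaithfulSMul ℂ[X] L] [Algebra.EssFiniteType ℂ[X] L] (x : Fin n → L),
      (∀ k, aeval x (F k) = 0) → x j = 0) :
    ∃ h : ℂ[X], h ≠ 0 ∧ ∃ N, C h * X j ^ N ∈ Ideal.span (Set.range F) := by
  classical
  by_contra hcon
  push Not at hcon
  let S : Submonoid (MvPolynomial (Fin n) ℂ[X]) :=
    (nonZeroDivisors ℂ[X]).map (C : ℂ[X] →+* MvPolynomial (Fin n) ℂ[X]) ⊔ Submonoid.powers (X j)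
  obtain ⟨p, hp, hIp, hdis⟩ := Ideal.exists_le_prime_disjoint (Ideal.span (Set.range F)) S (by
    rw [Set.disjoint_left]
    intro a ha haS
    obtain ⟨_, ⟨h, hh, rfl⟩, _, ⟨N, rfl⟩, rfl⟩ := Submonoid.mem_sup.mp haS
    exact hcon h (nonZeroDivisors.ne_zero hh) N ha)
  rw [Set.disjoint_left] at hdis
  let A := MvPolynomial (Fin n) ℂ[X] ⧸ p
  have hinj : Function.Injective (algebraMap ℂ[X] A) := by
    rw [injective_iff_map_eq_zero]
    intro h hh
    by_contra hne
    refine hdis (a := C h) ?_ (Submonoid.mem_sup_left ⟨h, mem_nonZeroDivisors_of_ne_zero hne, rfl⟩)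
    exact Ideal.Quotient.eq_zero_iff_mem.mp hh
  have := h_gen_aux F j hL (A := A) hinj (Ideal.Quotient.mkₐ ℂ[X] p) (fun k =>
    Ideal.Quotient.eq_zero_iff_mem.mpr (hIp (Ideal.subset_span ⟨k, rfl⟩)))
  exact hdis (Ideal.Quotient.eq_zero_iff_mem.mp this)
    (Submonoid.mem_sup_right (Submonoid.mem_powers _))

lemma h_vanish {n : ℕ} {ι B : Type*} [CommRing B] (F : ι → MvPolynomial (Fin n) ℂ[X])
    (φ : MvPolynomial (Fin n) ℂ[X] →+* B) (hφ : ∀ k, φ (F k) = 0)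
    {g} (hg : g ∈ Ideal.span (Set.range F)) : φ g = 0 := by
  have : Ideal.span (Set.range F) ≤ RingHom.ker φ := by
    rw [Ideal.span_le]; rintro _ ⟨k, rfl⟩; exact hφ k
  exact this hg

lemma h_ev (h : ℂ[X]) (h0 : h ≠ 0) : ∀ᶠ s in 𝓝[≠] (0:ℂ), h.eval s ≠ 0 := by
  have hf : {s | h.IsRoot s}.Finite := Polynomial.finite_setOfPred_isRoot h0
  have := (hf.subset (Set.sdiff_subset (t := {0}))).isClosed.isOpen_compl.mem_nhds
    (x := (0:ℂ)) (by simp)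
  rw [eventually_nhdsWithin_iff]
  filter_upwards [this] with s hs hs0 hs1
  exact hs ⟨hs1, hs0⟩

lemma h_euler {n d : ℕ} {L : Type*} [Field L] [Algebra ℂ L] (hd : d ≠ 0)
    (G : MvPolynomial (XS n) ℂ) (hG : IsWeightedHomogeneous (wtx n) G d) (a : XS n → L)
    (h : ∀ i, aeval a (pderiv (Sum.inl i) G) = 0) : aeval a G = 0 := by
  have he := congrArg (aeval a) hG.sum_weight_X_mul_pderiv
  have : CharZero L := charZero_of_injective_algebraMap (FaithfulSMul.algebraMap_injective ℂ L)
  simpa [Fintype.sum_sum_type, wtx, h, hd] using he.symm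

end Helpers

/-- For a one-parameter deformation of a FISI polynomial `f₀`:
`Y^∞ = {P_d(x,s) = 0} ⊂ ℙ^{n-1} × ℂ_s × ℂ_t` has no singular point with `|s| < ε` iff
`W₀ ∩ {φ_d = 0} = ∅`; in this case the critical points of `σ : Y^∞ → ℂ_s` (the points
of `Y^∞` where all `∂P_d/∂x_i` vanish) with `|s| < ε` are exactly `W₀ × {0} × ℂ`; in
particular `W_s = ∅` for `0 < |s| < ε`. -/
theorem stmt3 {n d : ℕ} (hn : 2 ≤ n) (hd : 2 ≤ d) (P : MvPolynomial (XS n) ℂ)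
    (hdeg : ∃ ε > (0:ℝ), ∀ s : ℂ, ‖s‖ < ε → DegXAt d P s)
    (hfisi : FISIat d P 0) :
    ((∃ ε > (0:ℝ), ∀ (v : Fin n → ℂ), v ≠ 0 → ∀ s : ℂ, ‖s‖ < ε →
        ¬ (eval (evA v s) (xpart P d) = 0 ∧ WCond d P v s ∧
            eval (evA v s) (pderiv (Sum.inr ()) (xpart P d)) = 0)) ↔
      ¬ ∃ x : Fin n → ℂ, x ≠ 0 ∧ WCond d P x 0 ∧ PhiCond d P x) ∧
    ((¬ ∃ x : Fin n → ℂ, x ≠ 0 ∧ WCond d P x 0 ∧ PhiCond d P x) →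
      ∃ ε > (0:ℝ),
        (∀ (v : Fin n → ℂ), v ≠ 0 → ∀ s : ℂ, ‖s‖ < ε →
          ((eval (evA v s) (xpart P d) = 0 ∧ WCond d P v s) ↔
            (s = 0 ∧ WCond d P v 0))) ∧
        (∀ s : ℂ, 0 < ‖s‖ → ‖s‖ < ε → ∀ v : Fin n → ℂ, v ≠ 0 → ¬ WCond d P v s)) := by
  classical
  set G := xpart P d with hGdef
  have hG : IsWeightedHomogeneous (wtx n) G d :=
    weightedHomogeneousComponent_isWeightedHomogeneous d P
  have hd0 : d ≠ 0 := by omega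
  -- Euler over the complex numbers
  have euler : ∀ (v : Fin n → ℂ) (s : ℂ), WCond d P v s → eval (evA v s) G = 0 := by
    intro v s hv
    have := h_euler hd0 G hG (evA v s) (fun i => by rw [← hv i, aeval_eq_eval])
    rwa [aeval_eq_eval] at this
  -- the full system
  let FA : Option (Fin n) → MvPolynomial (Fin n) (Polynomial ℂ) :=
    fun o => o.elim (hE (pderiv (Sum.inr ()) G)) (fun i => hE (pderiv (Sum.inl i) G))
  let FB : Fin n → MvPolynomial (Fin n) (Polynomial ℂ) := fun i => hE (pderiv (Sum.inl i) G)
  have nak : (¬ ∃ x : Fin n → ℂ, x ≠ 0 ∧ WCond d P x 0 ∧ PhiCond d P x) →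
      ∃ h : Polynomial ℂ, h.eval 0 ≠ 0 ∧ ∃ N, ∀ j, C h * X j ^ N ∈ Ideal.span (Set.range FA) := by
    intro hno
    refine h_nak FA (fun o => o.elim d (fun _ => d - 1)) ?_ ?_
    · rintro (_ | i)
      · exact hE_hom _ (hG.pderiv (by simp [wtx]))
      · exact hE_hom _ (hG.pderiv (by simp [wtx]; omega))
    · intro x hx
      by_contra hcon
      push Not at hcon
      refine hno ⟨x, hx, fun i => ?_, ?_⟩
      · rw [← hE_eval]; exact hcon (some i)
      · rw [PhiCond, ← hE_eval]; exact hcon none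
  constructor
  · constructor
    · rintro ⟨ε, hε, H⟩ ⟨x, hx, hW, hPhi⟩
      exact H x hx 0 (by simpa using hε) ⟨euler x 0 hW, hW, hPhi⟩
    · intro hno
      obtain ⟨h, hh, N, hN⟩ := nak hno
      have hev : ∀ᶠ s in 𝓝 (0:ℂ), h.eval s ≠ 0 :=
        h.continuous.continuousAt.eventually_ne hh
      obtain ⟨ε, hε, H⟩ := Metric.eventually_nhds_iff.mp hev
      refine ⟨ε, hε, fun v hv s hs hsing => ?_⟩
      obtain ⟨j, hj⟩ := Function.ne_iff.mp hv
      have := h_vanish FA (eval₂Hom (Polynomial.evalRingHom s) v) (by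
        rintro (_ | i)
        · exact (hE_eval _ _ _).trans hsing.2.2
        · exact (hE_eval _ _ _).trans (hsing.2.1 i)) (hN j)
      simp only [map_mul, map_pow, eval₂Hom_C, eval₂Hom_X'] at this
      exact mul_ne_zero (H (by simpa using hs)) (pow_ne_zero _ hj) this
  · intro hno
    obtain ⟨h, hh, N, hN⟩ := nak hno
    have hB : ∀ j, ∃ h : Polynomial ℂ, h ≠ 0 ∧ ∃ N, C h * X j ^ N ∈ Ideal.span (Set.range FB) := by
      intro j
      refine h_gen FB j ?_
      intro L _ _ _ _ _ _ x hx
      let a : XS n → L := Sum.elim x (fun _ => algebraMap (Polynomial ℂ) L Polynomial.X)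
      have hx' : ∀ i, aeval a (pderiv (Sum.inl i) G) = 0 := fun i => (hE_aeval _ _).symm.trans (hx i)
      have hs : aeval a (pderiv (Sum.inr ()) G) = 0 := by
        have hc := h_chain (KaehlerDifferential.D ℂ L) a G
        rw [h_euler hd0 G hG a hx', map_zero, Fintype.sum_sum_type] at hc
        simp only [hx', zero_smul, Finset.sum_const_zero, zero_add, Finset.univ_unique,
          Finset.sum_singleton] at hc
        exact (smul_eq_zero.mp hc.symm).resolve_right h_D_ne_zero
      have := h_vanish FA (aeval x).toRingHom (by
        rintro (_ | i)
        · exact (hE_aeval _ _).trans hs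
        · exact hx i) (hN j)
      simp only [AlgHom.toRingHom_eq_coe, RingHom.coe_coe, map_mul, map_pow, aeval_X, aeval_C] at this
      rcases mul_eq_zero.mp this with h1 | h1
      · rw [map_eq_zero_iff _ (FaithfulSMul.algebraMap_injective _ _)] at h1
        simp [h1] at hh
      · exact eq_zero_of_pow_eq_zero h1
    choose hb hb0 Nb hNb using hB
    have hev : ∀ᶠ s in 𝓝[≠] (0:ℂ), ∀ j, (hb j).eval s ≠ 0 :=
      eventually_all.mpr fun j => h_ev _ (hb0 j)
    rw [eventually_nhdsWithin_iff] at hev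
    obtain ⟨ε, hε, H⟩ := Metric.eventually_nhds_iff.mp hev
    have main : ∀ s : ℂ, 0 < ‖s‖ → ‖s‖ < ε → ∀ v : Fin n → ℂ, v ≠ 0 → ¬ WCond d P v s := by
      intro s hs0 hs v hv hW
      obtain ⟨j, hj⟩ := Function.ne_iff.mp hv
      have := h_vanish FB (eval₂Hom (Polynomial.evalRingHom s) v)
        (fun i => (hE_eval _ _ _).trans (hW i)) (hNb j)
      simp only [map_mul, map_pow, eval₂Hom_C, eval₂Hom_X'] at this
      exact mul_ne_zero (H (by simpa using hs) (norm_pos_iff.mp hs0) j) (pow_ne_zero _ hj) this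
    refine ⟨ε, hε, fun v hv s hs => ⟨fun ⟨_, hW⟩ => ?_, ?_⟩, main⟩
    · have hs0 : s = 0 := by
        by_contra hne
        exact main s (norm_pos_iff.mpr hne) hs v hv hW
      exact ⟨hs0, hs0 ▸ hW⟩
    · rintro ⟨rfl, hW⟩
      exact ⟨euler v 0 hW, hW⟩
end
end

section
/- Let f₀ be a FISI polynomial of degree d ≥ 2 and let P be a one-parameter general-at-infinity deformation of f₀. Assume that for some t ∈ ℂ the projective closure Y_{0,t} of f₀^{-1}(t) is nonsingular but tangent to the hyperplane at infinity H^∞ (equivalently: Σ₀ = ∅ and W₀ ≠ ∅). Then Γ_{III} ≠ ∅: there exist a sequence s_k → 0 with s_k ≠ 0 and points x_k ∈ ℂⁿ with ∂P/∂x_i(x_k, s_k) = 0 for all i and |P(x_k, s_k)| → ∞; that is, some affine critical values of f_{s_k} tend to infinity as s_k → 0. -/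
open MvPolynomial Filter CategoryTheory Limits Topology

noncomputable section

/-- evaluation of `F ∈ ℂ[s][Y]` at `Y = z`, `s = s`. -/
def ev2 (z s : ℂ) : Polynomial (Polynomial ℂ) →+* ℂ :=
  (Polynomial.evalRingHom z).comp (Polynomial.mapRingHom (Polynomial.evalRingHom s))

lemma ev2_apply (z s : ℂ) (F : Polynomial (Polynomial ℂ)) :
    ev2 z s F = (F.map (Polynomial.evalRingHom s)).eval z := rfl

lemma ev2_C (z s : ℂ) (r : Polynomial ℂ) : ev2 z s (Polynomial.C r) = r.eval s := by
  simp [ev2_apply]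

lemma ev2_cont (z : ℂ) (F : Polynomial (Polynomial ℂ)) : Continuous (fun s => ev2 z s F) := by
  have : (fun s => ev2 z s F) = fun s => (F.eval (Polynomial.C z)).eval s := by
    funext s
    rw [ev2_apply, Polynomial.eval_map]
    have := Polynomial.hom_eval₂ F (RingHom.id _) (Polynomial.evalRingHom s) (Polynomial.C z)
    simpa [Polynomial.eval₂_id] using this.symm
  rw [this]
  exact Polynomial.continuous _

lemma coprime_aux (K : Type) [Field K] [Algebra (Polynomial ℂ) K] [IsFractionRing (Polynomial ℂ) K] (Q F : Polynomial (Polynomial ℂ)) (hQ : Irreducible Q) (hdeg : Q.natDegree ≠ 0)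
    (hF : ¬ Q ∣ F) : ∃ (r : Polynomial ℂ) (a b : Polynomial (Polynomial ℂ)), r ≠ 0 ∧
      a * Q + b * F = Polynomial.C r := by
  have hprim : Q.IsPrimitive := hQ.isPrimitive hdeg
  have hirr : Irreducible (Q.map (algebraMap (Polynomial ℂ) K)) :=
    (hprim.irreducible_iff_irreducible_map_fraction_map (K := K)).1 hQ
  have hnd : ¬ (Q.map (algebraMap (Polynomial ℂ) K)) ∣ F.map (algebraMap _ K) := fun h =>
    hF ((hprim.dvd_iff_fraction_map_dvd_fraction_map K).2 h)
  obtain ⟨a, b, hab⟩ := (hirr.coprime_iff_not_dvd).2 hnd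
  obtain ⟨c, c0, hc⟩ := IsLocalization.integerNormalization_spec (nonZeroDivisors (Polynomial ℂ)) a
  obtain ⟨e, e0, he⟩ := IsLocalization.integerNormalization_spec (nonZeroDivisors (Polynomial ℂ)) b
  set a' := IsLocalization.integerNormalization (nonZeroDivisors (Polynomial ℂ)) a
  set b' := IsLocalization.integerNormalization (nonZeroDivisors (Polynomial ℂ)) b
  have ha : a'.map (algebraMap _ K) = Polynomial.C (algebraMap _ K c) * a := by
    ext i; simp [hc, Algebra.smul_def]
  have hb : b'.map (algebraMap _ K) = Polynomial.C (algebraMap _ K e) * b := by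
    ext i; simp [he, Algebra.smul_def]
  refine ⟨c * e, Polynomial.C e * a', Polynomial.C c * b', mul_ne_zero (nonZeroDivisors.ne_zero c0) (nonZeroDivisors.ne_zero e0), ?_⟩
  apply Polynomial.map_injective _ (IsFractionRing.injective (Polynomial ℂ) K)
  simp only [Polynomial.map_add, Polynomial.map_mul, Polynomial.map_C, ha, hb, map_mul]
  linear_combination (Polynomial.C (algebraMap _ K c) * Polynomial.C (algebraMap _ K e)) * hab

lemma coprime_lem (Q F : Polynomial (Polynomial ℂ)) (hQ : Irreducible Q) (hdeg : Q.natDegree ≠ 0)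
    (hF : ¬ Q ∣ F) : ∃ (r : Polynomial ℂ) (a b : Polynomial (Polynomial ℂ)), r ≠ 0 ∧
      a * Q + b * F = Polynomial.C r :=
  coprime_aux (FractionRing (Polynomial ℂ)) Q F hQ hdeg hF

lemma norm_bound (p : Polynomial ℂ) (δ : ℝ) (z : ℂ) (hz : ‖z‖ ≤ δ)
    (h : ∀ r, p.eval r = 0 → δ ≤ ‖r‖) : ‖p.eval z‖ ≤ 2 ^ p.natDegree * ‖p.eval 0‖ := by
  by_cases hp : p = 0
  · simp [hp]
  have hs := (IsAlgClosed.splits p)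
  have hev : ∀ w, p.eval w = p.leadingCoeff * (p.roots.map (fun r => w - r)).prod := by
    intro w
    conv_lhs => rw [hs.eq_prod_roots]
    simp [Polynomial.eval_multiset_prod]
  have key : ∀ m : Multiset ℂ, (∀ r ∈ m, δ ≤ ‖r‖) →
      ‖(m.map (fun r => z - r)).prod‖ ≤ 2 ^ (m.card) * ‖(m.map (fun r => 0 - r)).prod‖ := by
    intro m
    induction m using Multiset.induction_on with
    | empty => simp
    | cons a m ih =>
      intro hm
      have h1 := ih (fun r hr => hm r (Multiset.mem_cons_of_mem hr))
      have h2 : δ ≤ ‖a‖ := hm a (Multiset.mem_cons_self a m)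
      simp only [Multiset.map_cons, Multiset.prod_cons, norm_mul, Multiset.card_cons]
      have h3 : ‖z - a‖ ≤ 2 * ‖0 - a‖ := by
        have := norm_sub_le z a
        simp only [zero_sub, norm_neg]; linarith
      calc _ ≤ (2 * ‖0 - a‖) * (2 ^ (m.card) * ‖(m.map (fun r => 0 - r)).prod‖) := by gcongr
        _ = _ := by ring
  rw [hev z, hev 0, norm_mul, norm_mul, hs.natDegree_eq_card_roots]
  have := key p.roots (fun r hr => h r (by simpa using (Polynomial.mem_roots hp).1 hr))
  calc _ ≤ ‖p.leadingCoeff‖ * (2 ^ (p.roots.card) * ‖(p.roots.map (fun r => 0 - r)).prod‖) := by gcongr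
    _ = _ := by ring

lemma exists_small_nonroot (p : Polynomial ℂ) (hp : p ≠ 0) :
    ∀ᶠ z in 𝓝[≠] (0:ℂ), p.eval z ≠ 0 := by
  have : ((p.roots.toFinset : Set ℂ) \ {0})ᶜ ∈ 𝓝 (0:ℂ) :=
    ((p.roots.toFinset.finite_toSet.subset Set.sdiff_subset).isClosed.isOpen_compl).mem_nhds (by simp)
  rw [eventually_nhdsWithin_iff]
  filter_upwards [this] with z hz hz0 h
  apply hz
  simp only [Set.mem_sdiff, Finset.mem_coe, Multiset.mem_toFinset, Set.mem_singleton_iff]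
  exact ⟨(Polynomial.mem_roots hp).2 h, hz0⟩

lemma root_lem (Q : Polynomial (Polynomial ℂ)) (h0 : ev2 0 0 Q = 0)
    (hQ : Q.map (Polynomial.evalRingHom 0) ≠ 0) (δ : ℝ) (hδ : 0 < δ) :
    ∀ᶠ s in 𝓝 (0:ℂ), ∃ z, ‖z‖ < δ ∧ ev2 z s Q = 0 := by
  obtain ⟨z, hz1, hz2⟩ : ∃ z : ℂ, ‖z‖ ≤ δ ∧ ev2 z 0 Q ≠ 0 := by
    have h1 := exists_small_nonroot _ hQ
    have h2 : ∀ᶠ z in 𝓝[≠] (0:ℂ), z ∈ Metric.ball (0:ℂ) δ :=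
      (Metric.ball_mem_nhds (0:ℂ) hδ |> mem_nhdsWithin_of_mem_nhds)
    obtain ⟨z, h3, h4⟩ := (h1.and h2).exists
    exact ⟨z, by simpa using (le_of_lt (by simpa using h4)), h3⟩
  have hc : Continuous (fun s => 2 ^ Q.natDegree * ‖ev2 0 s Q‖ - ‖ev2 z s Q‖) := by
    have := ev2_cont 0 Q
    have := ev2_cont z Q
    fun_prop
  have : ∀ᶠ s in 𝓝 (0:ℂ), 2 ^ Q.natDegree * ‖ev2 0 s Q‖ - ‖ev2 z s Q‖ < 0 := by
    apply hc.continuousAt.eventually_lt continuousAt_const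
    simp [h0, hz2]
  filter_upwards [this] with s hs
  by_contra! hcon
  have := norm_bound (Q.map (Polynomial.evalRingHom s)) δ z hz1 (by
    intro r hr
    by_contra! hlt
    exact hcon r hlt hr)
  have h5 : (2:ℝ) ^ (Q.map (Polynomial.evalRingHom s)).natDegree ≤ 2 ^ Q.natDegree :=
    pow_le_pow_right₀ (by norm_num) Polynomial.natDegree_map_le
  have h6 := mul_le_mul_of_nonneg_right h5 (norm_nonneg (ev2 0 s Q))
  simp only [ev2_apply] at *
  linarith

lemma points_lem (q : Ideal (Polynomial (Polynomial ℂ))) [hq : q.IsPrime]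
    (h0 : ∀ F ∈ q, ev2 0 0 F = 0) (hs : Polynomial.C Polynomial.X ∉ q)
    (f : Polynomial (Polynomial ℂ)) (hf : f ∉ q) (δ : ℝ) (hδ : 0 < δ) :
    ∃ z s : ℂ, ‖z‖ < δ ∧ ‖s‖ < δ ∧ s ≠ 0 ∧ (∀ F ∈ q, ev2 z s F = 0) ∧ ev2 z s f ≠ 0 := by
  have hsm : ∀ᶠ s in 𝓝[≠] (0:ℂ), s ∈ Metric.ball (0:ℂ) δ :=
      (Metric.ball_mem_nhds (0:ℂ) hδ |> mem_nhdsWithin_of_mem_nhds)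
  have hne : ∀ᶠ s in 𝓝[≠] (0:ℂ), s ≠ 0 := eventually_mem_nhdsWithin
  by_cases hq0 : q = ⊥
  · have hf0 : f ≠ 0 := by rintro rfl; exact hf q.zero_mem
    have h1 := exists_small_nonroot f.leadingCoeff (by simpa using hf0)
    obtain ⟨s, ⟨h2, h3⟩, h4⟩ := ((h1.and hsm).and hne).exists
    have h5 : f.map (Polynomial.evalRingHom s) ≠ 0 := by
      intro h
      apply h2
      have := congrArg (fun p => Polynomial.coeff p f.natDegree) h
      simpa using this
    obtain ⟨z, h6, h7⟩ := ((exists_small_nonroot _ h5).and hsm).exists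
    refine ⟨z, s, by simpa using h7, by simpa using h3, h4, ?_, h6⟩
    intro F hF
    rw [hq0] at hF
    simp [(Ideal.mem_bot).1 hF]
  · -- no nonzero polynomial of s alone lies in q
    have hC : ∀ r : Polynomial ℂ, Polynomial.C r ∈ q → r = 0 := by
      intro r hr
      by_contra hr0
      obtain ⟨g, hg1, hg2⟩ := Polynomial.exists_eq_pow_rootMultiplicity_mul_and_not_dvd r hr0 0
      rw [hg1] at hr
      simp only [map_zero, sub_zero, map_mul, map_pow] at hr
      rcases hq.mem_or_mem hr with h | h
      · exact hs (hq.mem_of_pow_mem _ h)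
      · have := h0 _ h
        rw [ev2_C] at this
        exact hg2 (Polynomial.dvd_iff_isRoot.2 this)
    obtain ⟨Q, hQq, hQ⟩ := hq.exists_mem_prime_of_ne_bot hq0
    have hQd : Q.natDegree ≠ 0 := by
      intro h
      rw [Polynomial.eq_C_of_natDegree_eq_zero h] at hQq
      have := hC _ hQq
      apply hQ.ne_zero
      rw [Polynomial.eq_C_of_natDegree_eq_zero h, this]; simp
    have hdvd : ∀ F ∈ q, Q ∣ F := by
      intro F hF
      by_contra hnd
      obtain ⟨r, a, b, hr, hab⟩ := coprime_lem Q F hQ.irreducible hQd hnd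
      apply hr
      apply hC
      rw [← hab]
      exact q.add_mem (q.mul_mem_left _ hQq) (q.mul_mem_left _ hF)
    have hQ0 : Q.map (Polynomial.evalRingHom 0) ≠ 0 := by
      intro h
      have : Polynomial.C Polynomial.X ∣ Q := by
        rw [Polynomial.C_dvd_iff_dvd_coeff]
        intro i
        rw [Polynomial.X_dvd_iff, Polynomial.coeff_zero_eq_eval_zero]
        have := congrArg (fun p => Polynomial.coeff p i) h
        simpa using this
      obtain ⟨g, hg⟩ := this
      rw [hg] at hQq
      rcases hq.mem_or_mem hQq with h | h
      · exact hs h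
      · obtain ⟨g', hg'⟩ := hdvd g h
        have h1 : Polynomial.C Polynomial.X * g' = 1 := by
          have : Q * (Polynomial.C Polynomial.X * g') = Q * 1 := by
            rw [mul_one]; conv_rhs => rw [hg, hg']
            ring
          exact mul_left_cancel₀ hQ.ne_zero this
        have := congrArg (ev2 0 0) h1
        simp [ev2_C] at this
    obtain ⟨r, a, b, hr, hab⟩ := coprime_lem Q f hQ.irreducible hQd
      (fun h => hf (Ideal.mem_of_dvd _ h hQq))
    have h1 := exists_small_nonroot r hr
    have h2 : ∀ᶠ s in 𝓝[≠] (0:ℂ), ∃ z, ‖z‖ < δ ∧ ev2 z s Q = 0 :=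
      (root_lem Q (h0 Q hQq) hQ0 δ hδ).filter_mono nhdsWithin_le_nhds
    obtain ⟨s, ⟨⟨h3, h4⟩, h5⟩, z, h6, h7⟩ := (((h1.and hsm).and hne).and h2).exists
    refine ⟨z, s, h6, by simpa using h4, h5, ?_, ?_⟩
    · intro F hF
      obtain ⟨g, rfl⟩ := hdvd F hF
      simp [h7]
    · intro h8
      apply h3
      have := congrArg (ev2 z s) hab
      simpa [h7, h8, ev2_C] using this.symm

lemma height_point {σ : Type} [Finite σ] (a : σ → ℂ) :
    (vanishingIdeal ℂ ({a} : Set (σ → ℂ))).height = Nat.card σ := by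
  have htr : ∀ b : σ → ℂ, (vanishingIdeal ℂ ({b} : Set (σ → ℂ))).height =
      (vanishingIdeal ℂ ({a} : Set (σ → ℂ))).height := by
    intro b
    let e : MvPolynomial σ ℂ ≃ₐ[ℂ] MvPolynomial σ ℂ := AlgEquiv.ofAlgHom
      (aeval (fun i => X i + C (a i - b i))) (aeval (fun i => X i - C (a i - b i)))
      (by ext i; simp) (by ext i; simp)
    rw [← RingEquiv.height_comap e.toRingEquiv (vanishingIdeal ℂ ({b} : Set (σ → ℂ)))]
    congr 1
    ext F
    rw [Ideal.mem_comap]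
    simp only [mem_vanishingIdeal_iff, Set.mem_singleton_iff, forall_eq]
    have : aeval b (e.toRingEquiv F) = aeval a F := by
      change (aeval b) (aeval (fun i => X i + C (a i - b i)) F) = _
      rw [← AlgHom.comp_apply, comp_aeval]
      simp
    rw [this]
  have h1 := Ideal.sup_isMaximal_height_eq_ringKrullDim (R := MvPolynomial σ ℂ)
  rw [MvPolynomial.ringKrullDim_of_isNoetherianRing, ringKrullDim_eq_zero_of_field, zero_add] at h1
  have h2 : (⨆ (I : Ideal (MvPolynomial σ ℂ)) (_ : I.IsMaximal), I.height) =
      (vanishingIdeal ℂ ({a} : Set (σ → ℂ))).height := by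
    apply le_antisymm
    · refine iSup₂_le fun I hI => ?_
      obtain ⟨b, rfl⟩ := eq_vanishingIdeal_singleton_of_isMaximal ℂ hI
      exact (htr b).le
    · exact le_iSup₂_of_le (vanishingIdeal ℂ ({a} : Set (σ → ℂ)))
        (isMaximal_iff_eq_vanishingIdeal_singleton.2 ⟨a, rfl⟩) le_rfl
  rw [h2] at h1
  exact_mod_cast h1

lemma lift_lem {σ : Type} [Finite σ] (p : Ideal (MvPolynomial σ ℂ)) [hp : p.IsPrime] (iz is : σ)
    (a : σ → ℂ) (ha : ∀ F ∈ p, eval a F = 0) (haz : a iz = 0) (has : a is = 0)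
    (hs : X is ∉ p) (δ : ℝ) (hδ : 0 < δ) :
    ∃ b : σ → ℂ, (∀ F ∈ p, eval b F = 0) ∧ ‖b iz‖ < δ ∧ ‖b is‖ < δ ∧ b is ≠ 0 := by
  let φ : Polynomial (Polynomial ℂ) →+* MvPolynomial σ ℂ :=
    Polynomial.eval₂RingHom (Polynomial.eval₂RingHom C (X is)) (X iz)
  have hφC : ∀ r, φ (Polynomial.C r) = Polynomial.eval₂ C (X is) r := by intro r; simp [φ]
  have hev : ∀ b : σ → ℂ, (eval b).comp φ = ev2 (b iz) (b is) := by
    intro b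
    apply Polynomial.ringHom_ext'
    · apply Polynomial.ringHom_ext'
      · ext c; simp [φ, ev2_C]
      · simp [φ, ev2_C]
    · simp [φ, ev2_apply]
  have hfp : φ.FinitePresentation := by
    rw [← RingHom.FinitePresentation.of_finiteType]
    have : (φ.comp (Polynomial.C.comp Polynomial.C)).FiniteType := by
      have h : φ.comp (Polynomial.C.comp Polynomial.C) = algebraMap ℂ (MvPolynomial σ ℂ) := by
        ext c; simp [φ, MvPolynomial.algebraMap_eq]
      rw [h, RingHom.finiteType_algebraMap]
      infer_instance
    exact RingHom.FiniteType.of_comp_finiteType this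
  have hcl : IsConstructible (PrimeSpectrum.zeroLocus (p : Set (MvPolynomial σ ℂ))) := by
    rw [← isConstructible_compl]
    exact (PrimeSpectrum.isRetrocompact_zeroLocus_compl_of_fg
      (IsNoetherian.noetherian p)).isConstructible (PrimeSpectrum.isClosed_zeroLocus _).isOpen_compl
  have hc := PrimeSpectrum.isConstructible_comap_image hfp hcl
  obtain ⟨S, hS⟩ := PrimeSpectrum.exists_constructibleSetData_iff.2 hc
  let q := p.comap φ
  have hqmem : (⟨q, inferInstance⟩ : PrimeSpectrum (Polynomial (Polynomial ℂ))) ∈ S.toSet := by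
    rw [hS]
    exact ⟨⟨p, hp⟩, by simp [PrimeSpectrum.mem_zeroLocus], rfl⟩
  simp only [PrimeSpectrum.ConstructibleSetData.toSet, Set.mem_iUnion] at hqmem
  obtain ⟨D, hDS, hD⟩ := hqmem
  obtain ⟨hD1, hD2⟩ := hD
  simp only [PrimeSpectrum.mem_zeroLocus, Set.singleton_subset_iff, SetLike.mem_coe] at hD1 hD2
  obtain ⟨z, s, hz, hsδ, hs0, hVq, hf⟩ := points_lem q
    (fun F hF => by
      have := ha _ (Ideal.mem_comap.1 hF)
      have h2 := RingHom.congr_fun (hev a) F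
      rw [haz, has] at h2
      rw [← h2]; exact this)
    (fun h => hs (by
      have := Ideal.mem_comap.1 h
      rw [hφC] at this
      simpa using this)) D.f hD2 δ hδ
  -- the maximal ideal of the point (z, s)
  have hsurj : Function.Surjective (ev2 z s) := fun c => ⟨Polynomial.C (Polynomial.C c), by simp [ev2_C]⟩
  have hmax : (RingHom.ker (ev2 z s)).IsMaximal := RingHom.ker_isMaximal_of_surjective _ hsurj
  have hmem : (⟨RingHom.ker (ev2 z s), hmax.isPrime⟩ : PrimeSpectrum (Polynomial (Polynomial ℂ))) ∈ S.toSet := by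
    simp only [PrimeSpectrum.ConstructibleSetData.toSet, Set.mem_iUnion]
    refine ⟨D, hDS, ?_, ?_⟩
    · simp only [PrimeSpectrum.mem_zeroLocus]
      intro g hg
      exact hVq g (hD1 hg)
    · simpa [PrimeSpectrum.mem_zeroLocus] using hf
  rw [hS] at hmem
  obtain ⟨P', hP'1, hP'2⟩ := hmem
  obtain ⟨M, hM, hPM⟩ := Ideal.exists_le_maximal P'.asIdeal P'.2.ne_top
  obtain ⟨b, rfl⟩ := eq_vanishingIdeal_singleton_of_isMaximal ℂ hM
  have hle : RingHom.ker (ev2 z s) ≤ RingHom.ker (ev2 (b iz) (b is)) := by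
    intro F hF
    have h1 : F ∈ (PrimeSpectrum.comap φ P').asIdeal := by rw [hP'2]; exact hF
    have h2 := hPM (Ideal.mem_comap.1 h1)
    rw [RingHom.mem_ker, ← hev b]
    simpa [coe_aeval_eq_eval] using h2
  have hbs : b is = s := by
    have : Polynomial.C (Polynomial.X - Polynomial.C s) ∈ RingHom.ker (ev2 z s) := by
      simp [RingHom.mem_ker, ev2_apply]
    have := hle this
    rw [RingHom.mem_ker, ev2_C] at this
    simpa [sub_eq_zero] using this
  have hbz : b iz = z := by
    have : (Polynomial.X - Polynomial.C (Polynomial.C z)) ∈ RingHom.ker (ev2 z s) := by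
      simp [RingHom.mem_ker, ev2_apply]
    have := hle this
    rw [RingHom.mem_ker, ev2_apply] at this
    simpa [sub_eq_zero] using this
  refine ⟨b, ?_, by rwa [hbz], by rwa [hbs], by rwa [hbs]⟩
  intro F hF
  have := hPM (hP'1 hF)
  simpa [coe_aeval_eq_eval] using this

/-- `k` equations in more than `k` unknowns: a common zero `a` where the slice `X is = 0` of the
zero set is finite can be approached, as far as the coordinates `iz`, `is` are concerned. -/
lemma dim_lem {σ : Type} [Finite σ] (G : Finset (MvPolynomial σ ℂ)) (hcard : G.card < Nat.card σ)
    (iz is : σ) (a : σ → ℂ) (ha : ∀ F ∈ G, eval a F = 0) (haz : a iz = 0) (has : a is = 0)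
    (hfin : {b : σ → ℂ | b is = 0 ∧ ∀ F ∈ G, eval b F = 0}.Finite) (δ : ℝ) (hδ : 0 < δ) :
    ∃ b : σ → ℂ, (∀ F ∈ G, eval b F = 0) ∧ ‖b iz‖ < δ ∧ ‖b is‖ < δ ∧ b is ≠ 0 := by
  let m := vanishingIdeal ℂ ({a} : Set (σ → ℂ))
  have hm : m.IsMaximal := isMaximal_iff_eq_vanishingIdeal_singleton.2 ⟨a, rfl⟩
  have hle : Ideal.span (G : Set (MvPolynomial σ ℂ)) ≤ m := by
    rw [Ideal.span_le]
    intro F hF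
    simpa [m, coe_aeval_eq_eval] using ha F hF
  have : m.IsPrime := hm.isPrime
  obtain ⟨p, hp, hpm⟩ := Ideal.exists_minimalPrimes_le hle
  have hpp : p.IsPrime := hp.1.1
  have hGp : ∀ F ∈ G, F ∈ p := fun F hF => hp.1.2 (Ideal.subset_span hF)
  have hht := Ideal.height_le_card_of_mem_minimalPrimes_span_finset hp
  have hpnm : p ≠ m := by
    rintro h
    rw [h, height_point a] at hht
    have : Nat.card σ ≤ G.card := by exact_mod_cast hht
    omega
  have hs : X is ∉ p := by
    intro hs
    have hV : (zeroLocus ℂ p).Finite := by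
      apply hfin.subset
      intro b hb
      rw [mem_zeroLocus_iff] at hb
      exact ⟨by simpa using hb _ hs, fun F hF => by simpa [coe_aeval_eq_eval] using hb F (hGp F hF)⟩
    have hI : hV.toFinset.inf (fun b => vanishingIdeal ℂ ({b} : Set (σ → ℂ))) ≤ p := by
      intro F hF
      rw [← IsPrime.vanishingIdeal_zeroLocus (K := ℂ) p, mem_vanishingIdeal_iff]
      intro b hb
      have := (Finset.inf_le (f := fun b => vanishingIdeal ℂ ({b} : Set (σ → ℂ)))
        (hV.mem_toFinset.2 hb)) hF
      simpa using this
    obtain ⟨b, hb, hbp⟩ := (Ideal.IsPrime.inf_le' hpp).1 hI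
    have hbmax : (vanishingIdeal ℂ ({b} : Set (σ → ℂ))).IsMaximal :=
      isMaximal_iff_eq_vanishingIdeal_singleton.2 ⟨b, rfl⟩
    have h1 := hbmax.eq_of_le hpp.ne_top hbp
    rw [h1] at hbmax
    exact hpnm (hbmax.eq_of_le hm.ne_top hpm)
  obtain ⟨b, hb, h⟩ := lift_lem p iz is a (fun F hF => by simpa [m, coe_aeval_eq_eval] using hpm hF) haz has hs δ hδ
  exact ⟨b, fun F hF => hb F (hGp F hF), h⟩

lemma evA_cont {n : ℕ} {Y : Type*} [TopologicalSpace Y] (f : Y → Fin n → ℂ) (g : Y → ℂ)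
    (hf : Continuous f) (hg : Continuous g) (F : MvPolynomial (XS n) ℂ) :
    Continuous (fun y => eval (evA (f y) (g y)) F) := by
  refine (MvPolynomial.continuous_eval F).comp (continuous_pi ?_)
  rintro (i | i)
  · exact (continuous_apply i).comp hf
  · exact hg

lemma xpart_hom {n : ℕ} (P : MvPolynomial (XS n) ℂ) (q : ℕ) :
    IsWeightedHomogeneous (wtx n) (xpart P q) q :=
  weightedHomogeneousComponent_isWeightedHomogeneous q P

lemma scale_eval {n q : ℕ} (F : MvPolynomial (XS n) ℂ) (hF : IsWeightedHomogeneous (wtx n) F q)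
    (l : ℂ) (x : Fin n → ℂ) (s : ℂ) :
    eval (evA (l • x) s) F = l ^ q * eval (evA x s) F := by
  rw [eval_eq', eval_eq', Finset.mul_sum]
  refine Finset.sum_congr rfl fun m hm => ?_
  have hw := hF (mem_support_iff.1 hm)
  have hq : q = ∑ i : Fin n, m (Sum.inl i) := by
    rw [← hw, Finsupp.weight_apply, Finsupp.sum_fintype _ _ (by simp)]
    simp [wtx]
  rw [Fintype.prod_sum_type, Fintype.prod_sum_type]
  simp only [evA, Sum.elim_inl, Sum.elim_inr, Pi.smul_apply, smul_eq_mul, mul_pow,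
    Finset.prod_mul_distrib, Finset.prod_pow_eq_pow_sum]
  rw [← hq]; ring

lemma pderiv_deg_zero {n : ℕ} (F : MvPolynomial (XS n) ℂ) (hF : IsWeightedHomogeneous (wtx n) F 0)
    (i : Fin n) : pderiv (Sum.inl i) F = 0 := by
  apply pderiv_eq_zero_of_notMem_vars
  intro h
  obtain ⟨m, hm, him⟩ := (mem_vars _).1 h
  have hw := hF (mem_support_iff.1 hm)
  rw [Finsupp.weight_apply, Finsupp.sum_fintype _ _ (by simp)] at hw
  have := (Finset.sum_eq_zero_iff.1 hw) (Sum.inl i) (Finset.mem_univ _)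
  simp [wtx] at this
  exact (Finsupp.mem_support_iff.1 him) this

lemma scale_deriv {n q : ℕ} (F : MvPolynomial (XS n) ℂ) (hF : IsWeightedHomogeneous (wtx n) F q)
    (l : ℂ) (x : Fin n → ℂ) (s : ℂ) (i : Fin n) :
    l * eval (evA (l • x) s) (pderiv (Sum.inl i) F) =
      l ^ q * eval (evA x s) (pderiv (Sum.inl i) F) := by
  rcases q with _ | q
  · simp [pderiv_deg_zero F hF i]
  · have h : IsWeightedHomogeneous (wtx n) (pderiv (Sum.inl i) F) q :=
      hF.pderiv (by simp [wtx])
    rw [scale_eval _ h]; ring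

/-- the homogenized partial derivative `∂P̃/∂x_i (x, z, s)`. -/
def GG {n : ℕ} (d : ℕ) (P : MvPolynomial (XS n) ℂ) (i : Fin n) (x : Fin n → ℂ) (z s : ℂ) : ℂ :=
  ∑ q ∈ Finset.range (d+1), z ^ (d-q) * eval (evA x s) (pderiv (Sum.inl i) (xpart P q))

lemma GG_scale {n : ℕ} (d : ℕ) (P : MvPolynomial (XS n) ℂ) (i : Fin n) (x : Fin n → ℂ) (z s l : ℂ) :
    l * GG d P i (l • x) (l * z) s = l ^ d * GG d P i x z s := by
  unfold GG
  rw [Finset.mul_sum, Finset.mul_sum]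
  refine Finset.sum_congr rfl fun q hq => ?_
  have hqd : d = (d - q) + q := by have := Finset.mem_range.1 hq; omega
  have h := scale_deriv _ (xpart_hom P q) l x s i
  have h2 : l ^ d = l ^ (d - q) * l ^ q := by rw [← pow_add, ← hqd]
  rw [h2, mul_pow]
  linear_combination l ^ (d-q) * z ^ (d-q) * h

lemma GG_zero {n : ℕ} (d : ℕ) (P : MvPolynomial (XS n) ℂ) (i : Fin n) (x : Fin n → ℂ) (s : ℂ) :
    GG d P i x 0 s = eval (evA x s) (pderiv (Sum.inl i) (xpart P d)) := by
  unfold GG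
  rw [Finset.sum_range_succ, Finset.sum_eq_zero]
  · simp
  · intro q hq
    have := Finset.mem_range.1 hq
    rw [zero_pow (by omega), zero_mul]

lemma P_sum {n d : ℕ} (P : MvPolynomial (XS n) ℂ)
    (hdeg : ∃ ε > (0:ℝ), ∀ s : ℂ, ‖s‖ < ε → DegXAt d P s) :
    P = ∑ q ∈ Finset.range (d+1), xpart P q := by
  obtain ⟨ε, hε, h⟩ := hdeg
  have hz : ∀ q, d < q → xpart P q = 0 := by
    intro q hq
    refine MvPolynomial.funext_set (s := Sum.elim (fun _ => Set.univ) (fun _ => Metric.ball (0:ℂ) ε)) ?_ ?_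
    · rintro (i | i)
      · exact Set.infinite_univ
      · exact infinite_of_mem_nhds (0:ℂ) (Metric.ball_mem_nhds _ hε)
    · intro y hy
      have hs : ‖y (Sum.inr ())‖ < ε := by
        have := hy (Sum.inr ()) (Set.mem_univ _)
        simpa using this
      have := (h _ hs).1 q hq (fun i => y (Sum.inl i))
      have he : evA (fun i => y (Sum.inl i)) (y (Sum.inr ())) = y := by
        funext j; rcases j with j | j <;> rfl
      rw [he] at this
      simp [this]
  conv_lhs => rw [← sum_weightedHomogeneousComponent (wtx n) P]
  apply finsum_eq_sum_of_support_subset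
  intro q hq
  by_contra hqd
  apply hq
  exact hz q (by simpa using hqd)

lemma GG_one {n d : ℕ} (P : MvPolynomial (XS n) ℂ)
    (hP : P = ∑ q ∈ Finset.range (d+1), xpart P q) (i : Fin n) (x : Fin n → ℂ) (s : ℂ) :
    GG d P i x 1 s = eval (evA x s) (pderiv (Sum.inl i) P) := by
  conv_rhs => rw [hP]
  simp [GG]

lemma crit_iff {n d : ℕ} (P : MvPolynomial (XS n) ℂ)
    (hP : P = ∑ q ∈ Finset.range (d+1), xpart P q) (x : Fin n → ℂ) (z s : ℂ) (hz : z ≠ 0) :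
    CritPt P (z⁻¹ • x) s ↔ ∀ i, GG d P i x z s = 0 := by
  refine forall_congr' fun i => ?_
  rw [← GG_one P hP]
  have := GG_scale d P i x z s z⁻¹
  rw [inv_mul_cancel₀ hz] at this
  constructor
  · intro h
    rw [h, mul_zero] at this
    simpa [hz] using this.symm
  · intro h
    rw [h, mul_zero] at this
    simpa [hz] using this

/-- the polynomial whose values are `GG`. -/
def GGp {n : ℕ} (d : ℕ) (P : MvPolynomial (XS n) ℂ) (i : Fin n) : MvPolynomial (Fin n ⊕ Fin 2) ℂ :=
  ∑ q ∈ Finset.range (d+1), (X (Sum.inr 0)) ^ (d-q) *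
    aeval (Sum.elim (fun k => X (Sum.inl k)) (fun _ => X (Sum.inr 1)) :
      XS n → MvPolynomial (Fin n ⊕ Fin 2) ℂ) (pderiv (Sum.inl i) (xpart P q))

lemma eval_GGp {n : ℕ} (d : ℕ) (P : MvPolynomial (XS n) ℂ) (i : Fin n) (b : Fin n ⊕ Fin 2 → ℂ) :
    eval b (GGp d P i) = GG d P i (fun k => b (Sum.inl k)) (b (Sum.inr 0)) (b (Sum.inr 1)) := by
  unfold GGp GG
  rw [map_sum]
  refine Finset.sum_congr rfl fun q _ => ?_
  rw [map_mul, map_pow, eval_X]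
  congr 1
  rw [← coe_aeval_eq_eval, RingHom.coe_coe, ← AlgHom.comp_apply, comp_aeval]
  rw [← coe_aeval_eq_eval, RingHom.coe_coe]
  congr 2
  funext j
  rcases j with j | j <;> simp [evA]

lemma WCond_smul {n d : ℕ} (P : MvPolynomial (XS n) ℂ) (l : ℂ) (hl : l ≠ 0) (x : Fin n → ℂ) (s : ℂ)
    (h : WCond d P x s) : WCond d P (l • x) s := by
  intro i
  have := scale_deriv _ (xpart_hom P d) l x s i
  rw [h i, mul_zero] at this
  simpa [hl] using this

/-- existence of critical points escaping to infinity. -/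
lemma escape {n d : ℕ} (P : MvPolynomial (XS n) ℂ)
    (hP : P = ∑ q ∈ Finset.range (d+1), xpart P q)
    (hfisi : FISIat d P 0)
    (hGI : ∃ ε > (0:ℝ), ∀ s : ℂ, 0 < ‖s‖ → ‖s‖ < ε →
      ∀ x : Fin n → ℂ, WCond d P x s → x = 0)
    (hW : ∃ x : Fin n → ℂ, x ≠ 0 ∧ WCond d P x 0) (δ : ℝ) (hδ : 0 < δ) :
    ∃ (c : Fin n → ℂ) (s : ℂ), s ≠ 0 ∧ ‖s‖ < δ ∧ δ⁻¹ < ‖c‖ ∧ CritPt P c s := by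
  classical
  obtain ⟨w, hw0, hw⟩ := hW
  obtain ⟨j, hj⟩ := Function.ne_iff.1 hw0
  obtain ⟨ε, hε, hGI⟩ := hGI
  let v : Fin n → ℂ := (w j)⁻¹ • w
  have hv : WCond d P v 0 := WCond_smul P _ (inv_ne_zero hj) w 0 hw
  have hvj : v j = 1 := by simp [v, inv_mul_cancel₀ hj]
  let G : Finset (MvPolynomial (Fin n ⊕ Fin 2) ℂ) :=
    insert (X (Sum.inl j) - 1) (Finset.univ.image (GGp d P))
  have hG : ∀ b : Fin n ⊕ Fin 2 → ℂ, (∀ F ∈ G, eval b F = 0) ↔ (b (Sum.inl j) = 1 ∧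
      ∀ i, GG d P i (fun k => b (Sum.inl k)) (b (Sum.inr 0)) (b (Sum.inr 1)) = 0) := by
    intro b
    simp only [G, Finset.forall_mem_insert, Finset.forall_mem_image, Finset.mem_univ,
      true_implies, eval_GGp, map_sub, eval_X, map_one, sub_eq_zero]
  have hcard : G.card < Nat.card (Fin n ⊕ Fin 2) := by
    have h1 := Finset.card_insert_le (X (Sum.inl j) - 1) (Finset.univ.image (GGp d P))
    have h2 := Finset.card_image_le (s := Finset.univ) (f := GGp d P)
    simp only [Finset.card_univ, Fintype.card_fin] at h2
    simp only [Nat.card_eq_fintype_card, Fintype.card_sum, Fintype.card_fin, G]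
    omega
  let a : Fin n ⊕ Fin 2 → ℂ := Sum.elim v (fun _ => 0)
  have hfin : {b : Fin n ⊕ Fin 2 → ℂ | b (Sum.inr 1) = 0 ∧ ∀ F ∈ G, eval b F = 0}.Finite := by
    let A : Set (Fin n ⊕ Fin 2 → ℂ) := {b | b (Sum.inr 1) = 0 ∧ b (Sum.inr 0) ≠ 0 ∧
      b (Sum.inl j) = 1 ∧ ∀ i, GG d P i (fun k => b (Sum.inl k)) (b (Sum.inr 0)) 0 = 0}
    let B : Set (Fin n ⊕ Fin 2 → ℂ) := {b | b (Sum.inr 1) = 0 ∧ b (Sum.inr 0) = 0 ∧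
      b (Sum.inl j) = 1 ∧ ∀ i, GG d P i (fun k => b (Sum.inl k)) 0 0 = 0}
    have hA : A.Finite := by
      refine Set.Finite.of_finite_image (f := fun b => (b (Sum.inr 0))⁻¹ • fun k => b (Sum.inl k))
        (hfisi.1.subset ?_) ?_
      · rintro _ ⟨b, ⟨-, h2, -, h4⟩, rfl⟩
        exact (crit_iff P hP _ _ _ h2).2 h4
      · rintro b ⟨h1, h2, h3, -⟩ b' ⟨h1', h2', h3', -⟩ he
        have hz : b (Sum.inr 0) = b' (Sum.inr 0) := by
          have := congrFun he j
          simpa [h3, h3'] using this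
        funext k
        rcases k with k | k
        · have := congrFun he k
          simpa [hz, h2'] using this
        · fin_cases k
          · exact hz
          · exact h1.trans h1'.symm
    have hB : B.Finite := by
      have hne : ∀ b : Fin n ⊕ Fin 2 → ℂ, b ∈ B → (fun k => b (Sum.inl k)) ≠ 0 := by
        intro b hb h
        have := congrFun h j
        simp [hb.2.2.1] at this
      let f : (Fin n ⊕ Fin 2 → ℂ) → PrjInf n := fun b =>
        if h : (fun k => b (Sum.inl k)) ≠ 0 then Projectivization.mk ℂ _ h
        else Projectivization.mk ℂ w hw0
      refine Set.Finite.of_finite_image (f := f) (hfisi.2.2.subset ?_) ?_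
      · rintro _ ⟨b, hb, rfl⟩
        have h := hne b hb
        have hfb : f b = Projectivization.mk ℂ _ h := by simp only [f]; rw [dif_pos h]
        rw [hfb]
        change WCond d P _ 0
        obtain ⟨u, hu⟩ := Projectivization.exists_smul_eq_mk_rep ℂ _ h
        rw [← hu]
        refine WCond_smul P (u : ℂ) u.ne_zero _ 0 ?_
        intro i
        rw [← GG_zero]
        exact hb.2.2.2 i
      · intro b hb b' hb' he
        have h := hne b hb
        have h' := hne b' hb'
        simp only [f] at he
        rw [dif_pos h, dif_pos h', Projectivization.mk_eq_mk_iff'] at he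
        obtain ⟨u, hu⟩ := he
        have hu1 : u = 1 := by
          have := congrFun hu j
          simpa [hb.2.2.1, hb'.2.2.1] using this
        funext k
        rcases k with k | k
        · have := congrFun hu k
          simpa [hu1] using this.symm
        · fin_cases k
          · exact hb.2.1.trans hb'.2.1.symm
          · exact hb.1.trans hb'.1.symm
    refine (hA.union hB).subset ?_
    rintro b ⟨h1, h2⟩
    obtain ⟨h3, h4⟩ := (hG b).1 h2
    rw [h1] at h4
    by_cases hz : b (Sum.inr 0) = 0
    · right
      rw [hz] at h4
      exact ⟨h1, hz, h3, h4⟩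
    · left
      exact ⟨h1, hz, h3, h4⟩
  obtain ⟨b, hb, hbz, hbs, hbs0⟩ := dim_lem G hcard (Sum.inr 0) (Sum.inr 1) a
    ((hG a).2 ⟨hvj, fun i => by
      change GG d P i v 0 0 = 0
      rw [GG_zero]; exact hv i⟩) rfl rfl hfin (min δ ε) (lt_min hδ hε)
  obtain ⟨hbj, hbG⟩ := (hG b).1 hb
  have hz0 : b (Sum.inr 0) ≠ 0 := by
    intro hz
    rw [hz] at hbG
    have := hGI (b (Sum.inr 1)) (norm_pos_iff.2 hbs0) (lt_of_lt_of_le hbs (min_le_right _ _))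
      (fun k => b (Sum.inl k)) (fun i => by rw [← GG_zero]; exact hbG i)
    have := congrFun this j
    simp [hbj] at this
  refine ⟨(b (Sum.inr 0))⁻¹ • fun k => b (Sum.inl k), b (Sum.inr 1), hbs0,
    lt_of_lt_of_le hbs (min_le_left _ _), ?_, (crit_iff P hP _ _ _ hz0).2 hbG⟩
  have h1 : ‖((b (Sum.inr 0))⁻¹ • fun k => b (Sum.inl k)) j‖ ≤
    ‖(b (Sum.inr 0))⁻¹ • fun k => b (Sum.inl k)‖ := norm_le_pi_norm _ j
  refine lt_of_lt_of_le ?_ h1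
  simp only [Pi.smul_apply, hbj, smul_eq_mul, mul_one, norm_inv]
  exact (inv_lt_inv₀ hδ (norm_pos_iff.2 hz0)).2 (lt_of_lt_of_le hbz (min_le_left _ _))

/-- Euler's identity at a critical point. -/
lemma euler_crit {n d : ℕ} (P : MvPolynomial (XS n) ℂ)
    (hP : P = ∑ q ∈ Finset.range (d+1), xpart P q) (x : Fin n → ℂ) (s : ℂ) (hc : CritPt P x s) :
    (d : ℂ) * eval (evA x s) P =
      ∑ q ∈ Finset.range d, ((d : ℂ) - q) * eval (evA x s) (xpart P q) := by
  have hE : ∀ q, ∑ i : Fin n, x i * eval (evA x s) (pderiv (Sum.inl i) (xpart P q)) =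
      q * eval (evA x s) (xpart P q) := by
    intro q
    have := congrArg (eval (evA x s)) ((xpart_hom P q).sum_weight_X_mul_pderiv)
    simpa [wtx, evA] using this
  have h0 : ∑ q ∈ Finset.range (d+1), (q : ℂ) * eval (evA x s) (xpart P q) = 0 := by
    calc _ = ∑ q ∈ Finset.range (d+1), ∑ i : Fin n,
          x i * eval (evA x s) (pderiv (Sum.inl i) (xpart P q)) := by
          refine Finset.sum_congr rfl fun q _ => (hE q).symm
      _ = ∑ i : Fin n, x i * GG d P i x 1 s := by
          rw [Finset.sum_comm]
          refine Finset.sum_congr rfl fun i _ => ?_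
          simp [GG, Finset.mul_sum]
      _ = 0 := by
          refine Finset.sum_eq_zero fun i _ => ?_
          rw [GG_one P hP, hc i, mul_zero]
  have h1 : (d : ℂ) * eval (evA x s) P =
      ∑ q ∈ Finset.range (d+1), ((d : ℂ) - q) * eval (evA x s) (xpart P q) := by
    conv_lhs => rw [hP]
    simp only [sub_mul, Finset.sum_sub_distrib, h0, sub_zero, map_sum, Finset.mul_sum]
  rw [h1, Finset.sum_range_succ]; simp

/-- For a general-at-infinity deformation of a FISI polynomial `f₀`
with `Σ₀ = ∅` and `W₀ ≠ ∅` (i.e. some `Y_{0,t}` is nonsingular but tangent to `H^∞`),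
one has `Γ_III ≠ ∅`: there are critical points of `f_{s_k}`, `s_k → 0`, `s_k ≠ 0`,
whose critical values tend to infinity. -/
theorem stmt7 {n d : ℕ} (hn : 2 ≤ n) (hd : 2 ≤ d) (P : MvPolynomial (XS n) ℂ)
    (hdeg : ∃ ε > (0:ℝ), ∀ s : ℂ, ‖s‖ < ε → DegXAt d P s)
    (hfisi : FISIat d P 0)
    (hGI : ∃ ε > (0:ℝ), ∀ s : ℂ, 0 < ‖s‖ → ‖s‖ < ε →
      ∀ x : Fin n → ℂ, WCond d P x s → x = 0)
    (hSig : ∀ x : Fin n → ℂ, x ≠ 0 → ¬ SCond d P x 0)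
    (hW : ∃ x : Fin n → ℂ, x ≠ 0 ∧ WCond d P x 0) :
    ∃ (x : ℕ → Fin n → ℂ) (s : ℕ → ℂ),
      (∀ k, s k ≠ 0) ∧ Tendsto s atTop (nhds 0) ∧
      (∀ k, CritPt P (x k) (s k)) ∧
      Tendsto (fun k => ‖eval (evA (x k) (s k)) P‖) atTop atTop := by
  have hP := P_sum P hdeg
  choose c s hs0 hsδ hcδ hcrit using fun k : ℕ =>
    escape P hP hfisi hGI hW (1 / ((k : ℝ) + 1)) Nat.one_div_pos_of_nat
  have hst : Tendsto s atTop (𝓝 0) :=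
    squeeze_zero_norm (fun k => (hsδ k).le) tendsto_one_div_add_atTop_nhds_zero_nat
  have hct : Tendsto (fun k => ‖c k‖) atTop atTop := by
    refine tendsto_atTop_mono (f := fun k : ℕ => (k : ℝ)) (fun k => ?_) tendsto_natCast_atTop_atTop
    have := hcδ k
    simp only [one_div, inv_inv] at this
    linarith
  have hcpos : ∀ k, 0 < ‖c k‖ := fun k =>
    lt_trans (inv_pos.2 Nat.one_div_pos_of_nat) (hcδ k)
  let z : ℕ → ℂ := fun k => ((‖c k‖⁻¹ : ℝ) : ℂ)
  have hz0 : ∀ k, z k ≠ 0 := fun k => by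
    simp only [z, ne_eq, Complex.ofReal_eq_zero, inv_eq_zero]; exact (hcpos k).ne'
  have hzt : Tendsto z atTop (𝓝 0) := by
    have h1 : Tendsto (fun k => ‖c k‖⁻¹) atTop (𝓝 0) := tendsto_inv_atTop_zero.comp hct
    have h2 := (Complex.continuous_ofReal.tendsto 0).comp h1
    simpa [z, Function.comp_def] using h2
  let v : ℕ → Fin n → ℂ := fun k => z k • c k
  have hcv : ∀ k, c k = (z k)⁻¹ • v k := fun k => by
    simp only [v]; rw [inv_smul_smul₀ (hz0 k)]
  have hvs : ∀ k, v k ∈ Metric.sphere (0 : Fin n → ℂ) 1 := fun k => by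
    simp only [v, z, mem_sphere_zero_iff_norm, norm_smul, Complex.norm_real, norm_inv, norm_norm]
    exact inv_mul_cancel₀ (hcpos k).ne'
  obtain ⟨v0, hv0, φ, hφ, hlim⟩ := (isCompact_sphere (0 : Fin n → ℂ) 1).tendsto_subseq hvs
  have hv0ne : v0 ≠ 0 := by
    rintro rfl
    simp at hv0
  have hφt := hφ.tendsto_atTop
  have htr : Tendsto (fun k => ((v (φ k), z (φ k)), s (φ k))) atTop (𝓝 ((v0, 0), 0)) :=
    ((hlim.prodMk_nhds (hzt.comp hφt)).prodMk_nhds (hst.comp hφt))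
  have hWv : WCond d P v0 0 := by
    intro i
    have hcont : Continuous (fun y : ((Fin n → ℂ) × ℂ) × ℂ => GG d P i y.1.1 y.1.2 y.2) := by
      unfold GG
      refine continuous_finsetSum _ fun q _ => Continuous.mul (by fun_prop) ?_
      exact evA_cont _ _ (by fun_prop) (by fun_prop) _
    have h1 := (hcont.tendsto ((v0, 0), 0)).comp htr
    have h2 : ((fun y : ((Fin n → ℂ) × ℂ) × ℂ => GG d P i y.1.1 y.1.2 y.2) ∘
        fun k => ((v (φ k), z (φ k)), s (φ k))) = fun _ => 0 := by
      funext k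
      have := hcrit (φ k)
      rw [hcv (φ k)] at this
      exact (crit_iff P hP _ _ _ (hz0 _)).1 this i
    rw [h2] at h1
    have := tendsto_nhds_unique h1 tendsto_const_nhds
    rw [← GG_zero]
    exact this
  have hPv : eval (evA v0 0) (xpart P (d-1)) ≠ 0 := fun h => hSig v0 hv0ne ⟨hWv, h⟩
  let H : ((Fin n → ℂ) × ℂ) × ℂ → ℂ := fun y =>
    ∑ q ∈ Finset.range d, ((d : ℂ) - q) * (y.1.2 ^ (d - 1 - q) * eval (evA y.1.1 y.2) (xpart P q))
  have hHc : Continuous H := by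
    refine continuous_finsetSum _ fun q _ => continuous_const.mul (Continuous.mul (by fun_prop) ?_)
    exact evA_cont _ _ (by fun_prop) (by fun_prop) _
  have hH0 : H ((v0, 0), 0) = eval (evA v0 0) (xpart P (d-1)) := by
    obtain ⟨e, rfl⟩ : ∃ e, d = e + 1 := ⟨d - 1, by omega⟩
    simp only [H]
    rw [Finset.sum_range_succ, Finset.sum_eq_zero]
    · simp
    · intro q hq
      have := Finset.mem_range.1 hq
      rw [zero_pow (by omega)]; simp
  have hval : ∀ k, (d : ℂ) * eval (evA (c k) (s k)) P =
      (z k)⁻¹ ^ (d-1) * H ((v k, z k), s k) := by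
    intro k
    rw [euler_crit P hP _ _ (hcrit k), Finset.mul_sum]
    refine Finset.sum_congr rfl fun q hq => ?_
    rw [hcv k, scale_eval _ (xpart_hom P q)]
    have hq' := Finset.mem_range.1 hq
    have h1 : (z k)⁻¹ ^ (d-1) = (z k)⁻¹ ^ (d - 1 - q) * (z k)⁻¹ ^ q := by
      rw [← pow_add]; congr 1; omega
    have h2 : (z k)⁻¹ ^ (d - 1 - q) * (z k) ^ (d - 1 - q) = 1 := by
      rw [← mul_pow, inv_mul_cancel₀ (hz0 k), one_pow]
    rw [h1]
    linear_combination (-((d : ℂ) - q) * (z k)⁻¹ ^ q * eval (evA (v k) (s k)) (xpart P q)) * h2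
  have hHt : Tendsto (fun k => ‖H ((v (φ k), z (φ k)), s (φ k))‖) atTop
      (𝓝 ‖eval (evA v0 0) (xpart P (d-1))‖) := by
    rw [← hH0]
    exact ((hHc.tendsto _).comp htr).norm
  have hpow : Tendsto (fun k => ‖c (φ k)‖ ^ (d-1)) atTop atTop :=
    (tendsto_pow_atTop (by omega)).comp (hct.comp hφt)
  have hprod := hpow.atTop_mul_pos (norm_pos_iff.2 hPv) hHt
  have hd0 : (0:ℝ) < d := by exact_mod_cast (by omega : 0 < d)
  have hfinal := hprod.const_mul_atTop (inv_pos.2 hd0)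
  refine ⟨fun k => c (φ k), fun k => s (φ k), fun k => hs0 _, hst.comp hφt, fun k => hcrit _, ?_⟩
  refine hfinal.congr fun k => ?_
  have := congrArg norm (hval (φ k))
  simp only [norm_mul, norm_pow, norm_inv, z, Complex.norm_real, norm_norm, inv_inv,
    Complex.norm_natCast] at this
  rw [← this, inv_mul_cancel_left₀ hd0.ne']
end
end
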